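/- arXiv:math/0411274 — 4 statements merged into one kernel-verified Lean document; each statement's English description precedes it below -/
import Mathlib

section
/- Let 0<q<1 and let N and r be positive integers with N ≥ r. Then the sum of the shifted multiple q-zeta values ζ*[n_1,n_2,...,n_r] = ζ[1+n_1,n_2,...,n_r], taken over all tuples of positive integers (n_1,...,n_r) with n_1+n_2+...+n_r = N, equals ζ*[N] = ζ[1+N]. -/
/-- The `q`-analog of a natural number: `[k]_q = (1-q^k)/(1-q)`. -/
noncomputable def qnum (q : ℝ) (k : ℕ) : ℝ := (1 - q ^ k) / (1 - q)

/-- The multiple `q`-zeta value `ζ[n₁,…,n_r]`, summed over all strictly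
decreasing tuples of positive integers `k₁ > k₂ > ⋯ > k_r > 0`. -/
noncomputable def qmzv (q : ℝ) {r : ℕ} (n : Fin r → ℕ) : ℝ :=
  ∑' k : {k : Fin r → ℕ // (∀ i j : Fin r, i < j → k j < k i) ∧ ∀ j, 0 < k j},
    ∏ j : Fin r, q ^ ((n j - 1) * k.1 j) / (qnum q (k.1 j)) ^ (n j)

open Filter Topology ENNReal

/-- The tuples `k₁ > ⋯ > k_r > 0` indexing a multiple `q`-zeta value. -/
abbrev DecTuple (r : ℕ) : Type :=
  {k : Fin r → ℕ // (∀ i j : Fin r, i < j → k j < k i) ∧ ∀ j, 0 < k j}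

/-- The largest entry of a decreasing tuple, with value `0` on the empty tuple. -/
def DecTuple.head {r : ℕ} (k : DecTuple r) : ℕ := if h : 0 < r then k.1 ⟨0, h⟩ else 0

lemma DecTuple.le_head {r : ℕ} (k : DecTuple r) (j : Fin r) : k.1 j ≤ k.head := by
  have h : 0 < r := j.pos
  rw [DecTuple.head, dif_pos h]
  rcases Nat.eq_zero_or_pos j.val with h0 | h0
  · have : j = ⟨0, h⟩ := Fin.ext h0
    rw [this]
  · exact (k.2.1 ⟨0, h⟩ j h0).le

/-- Prepending a new largest entry to a decreasing tuple. -/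
def DecTuple.consEquiv (r : ℕ) : DecTuple r × ℕ ≃ DecTuple (r + 1) where
  toFun p := ⟨Fin.cons (p.1.head + 1 + p.2) p.1.1, by
    constructor
    · intro i j hij
      induction j using Fin.cases with
      | zero => exact absurd hij (Fin.not_lt_zero i)
      | succ j =>
        induction i using Fin.cases with
        | zero =>
          have := p.1.le_head j
          simp only [Fin.cons_succ, Fin.cons_zero]
          omega
        | succ i => simpa using p.1.2.1 i j (by simpa using hij)
    · intro j
      induction j using Fin.cases with
      | zero => simp only [Fin.cons_zero]; omega
      | succ j => simpa using p.1.2.2 j⟩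
  invFun k :=
    let k' : DecTuple r := ⟨fun j => k.1 j.succ,
      fun i j hij => k.2.1 _ _ (by simpa using hij), fun j => k.2.2 _⟩
    (k', k.1 0 - (k'.head + 1))
  left_inv p := by
    refine Prod.ext (Subtype.ext (funext fun j => by simp)) ?_
    simp
  right_inv k := by
    refine Subtype.ext (funext fun j => ?_)
    induction j using Fin.cases with
    | zero =>
      simp only [Fin.cons_zero]
      apply Nat.add_sub_cancel'
      simp only [DecTuple.head]
      split_ifs with h
      · exact k.2.1 _ _ (Fin.succ_pos _)
      · exact k.2.2 0
    | succ j => simp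

@[simp] lemma DecTuple.consEquiv_zero {r : ℕ} (p : DecTuple r × ℕ) :
    (DecTuple.consEquiv r p).1 0 = p.1.head + 1 + p.2 := rfl

@[simp] lemma DecTuple.consEquiv_succ {r : ℕ} (p : DecTuple r × ℕ) (j : Fin r) :
    (DecTuple.consEquiv r p).1 j.succ = p.1.1 j := rfl

lemma DecTuple.head_succ {r : ℕ} (k : DecTuple (r + 1)) : k.head = k.1 0 := by
  simp [DecTuple.head]

lemma DecTuple.tsum_succ {r : ℕ} (F : DecTuple (r + 1) → ℝ≥0∞) :
    ∑' k, F k = ∑' k : DecTuple r, ∑' i, F (DecTuple.consEquiv r (k, i)) := by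
  rw [← (DecTuple.consEquiv r).tsum_eq F, ENNReal.tsum_prod']

lemma ENNReal.tsum_fin_pi_prod {r : ℕ} (F : Fin r → ℕ → ℝ≥0∞) :
    ∑' e : Fin r → ℕ, ∏ j, F j (e j) = ∏ j, ∑' i, F j i := by
  induction r with
  | zero => simp
  | succ r ih =>
    rw [← (Fin.consEquiv fun _ : Fin (r + 1) => ℕ).tsum_eq, ENNReal.tsum_prod', Fin.prod_univ_succ,
      ← ih, ← ENNReal.tsum_mul_right]
    refine tsum_congr fun i => ?_
    rw [← ENNReal.tsum_mul_left]
    refine tsum_congr fun e => ?_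
    simp [Fin.prod_univ_succ, Fin.consEquiv]

lemma qnum_add {q : ℝ} (hq1 : q < 1) (m n : ℕ) : qnum q (m + n) = qnum q m + q ^ m * qnum q n := by
  have : 1 - q ≠ 0 := by linarith
  simp only [qnum]
  field_simp
  ring

lemma qnum_one {q : ℝ} (hq1 : q < 1) : qnum q 1 = 1 := by
  have : 1 - q ≠ 0 := by linarith
  simp [qnum, this]

lemma qnum_nonneg {q : ℝ} (hq0 : 0 < q) (hq1 : q < 1) (n : ℕ) : 0 ≤ qnum q n :=
  div_nonneg (sub_nonneg.2 (pow_le_one₀ hq0.le hq1.le)) (by linarith)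

lemma one_le_qnum {q : ℝ} (hq0 : 0 < q) (hq1 : q < 1) {n : ℕ} (hn : 0 < n) : 1 ≤ qnum q n := by
  obtain ⟨n, rfl⟩ := Nat.exists_eq_add_of_lt hn
  rw [zero_add, add_comm, qnum_add hq1, qnum_one hq1]
  have := mul_nonneg (pow_pos hq0 1).le (qnum_nonneg hq0 hq1 n)
  linarith

/-- The ratio `q^k / [k]_q`. -/
noncomputable def qratio (q : ℝ) (k : ℕ) : ℝ := q ^ k / qnum q k

/-- The deformation `[k]_q - t q^k` of the `q`-number `[k]_q`. -/
noncomputable def qden (q t : ℝ) (k : ℕ) : ℝ := qnum q k - t * q ^ k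

/-- The deformed `q`-factorial `∏_{1 ≤ j ≤ m} ([j]_q - t q^j)`. -/
noncomputable def qfac (q t : ℝ) (m : ℕ) : ℝ := ∏ j ∈ Finset.range m, qden q t (j + 1)

/-- The symmetric kernel `q^{nm} f(n) f(m) / f(n+m)`, where `f` is the deformed `q`-factorial. -/
noncomputable def qconn (q t : ℝ) (n m : ℕ) : ℝ :=
  q ^ (n * m) * qfac q t n * qfac q t m / qfac q t (n + m)

lemma qratio_nonneg {q : ℝ} (hq0 : 0 < q) (hq1 : q < 1) (k : ℕ) : 0 ≤ qratio q k :=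
  div_nonneg (pow_pos hq0 k).le (qnum_nonneg hq0 hq1 k)

lemma qratio_le {q : ℝ} (hq0 : 0 < q) (hq1 : q < 1) {k : ℕ} (hk : 0 < k) : qratio q k ≤ q ^ k :=
  div_le_self (pow_pos hq0 k).le (one_le_qnum hq0 hq1 hk)

lemma qden_add {q : ℝ} (hq1 : q < 1) (t : ℝ) (n m : ℕ) :
    qden q t (n + m) = qnum q n + q ^ n * qden q t m := by
  simp only [qden, qnum_add hq1, pow_add]
  ring

lemma le_qden {q t : ℝ} (hq0 : 0 < q) (hq1 : q < 1) (ht1 : t ≤ 1) {k : ℕ} (hk : 0 < k) :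
    1 - q ≤ qden q t k := by
  have h1 := one_le_qnum hq0 hq1 hk
  have h2 : q ^ k ≤ q := pow_le_of_le_one hq0.le hq1.le hk.ne'
  have h3 : t * q ^ k ≤ q ^ k := mul_le_of_le_one_left (pow_pos hq0 k).le ht1
  simp only [qden]
  linarith

lemma qden_pos {q t : ℝ} (hq0 : 0 < q) (hq1 : q < 1) (ht1 : t ≤ 1) {k : ℕ} (hk : 0 < k) :
    0 < qden q t k :=
  (sub_pos.2 hq1).trans_le (le_qden hq0 hq1 ht1 hk)

lemma qden_mono {q t : ℝ} (hq0 : 0 < q) (hq1 : q < 1) (ht0 : 0 ≤ t) : Monotone (qden q t) := by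
  refine monotone_nat_of_le_succ fun k => ?_
  have h1 : q ^ (k + 1) ≤ q ^ k := pow_le_pow_of_le_one hq0.le hq1.le k.le_succ
  have h2 := mul_le_mul_of_nonneg_left h1 ht0
  have h3 := (pow_pos hq0 k).le
  simp only [qden, qnum_add hq1 k 1, qnum_one hq1]
  linarith

lemma qfac_pos {q t : ℝ} (hq0 : 0 < q) (hq1 : q < 1) (ht1 : t ≤ 1) (m : ℕ) : 0 < qfac q t m :=
  Finset.prod_pos fun j _ => qden_pos hq0 hq1 ht1 j.succ_pos

lemma qfac_succ (q t : ℝ) (m : ℕ) : qfac q t (m + 1) = qfac q t m * qden q t (m + 1) :=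
  Finset.prod_range_succ _ _

lemma qfac_mul_le {q t : ℝ} (hq0 : 0 < q) (hq1 : q < 1) (ht0 : 0 ≤ t) (ht1 : t ≤ 1) (n m : ℕ) :
    qfac q t n * qfac q t m ≤ qfac q t (n + m) := by
  induction m with
  | zero => simp [qfac]
  | succ m ih =>
    rw [← add_assoc, qfac_succ, qfac_succ, ← mul_assoc]
    exact mul_le_mul ih (qden_mono hq0 hq1 ht0 (by omega)) (qden_pos hq0 hq1 ht1 m.succ_pos).le
      (qfac_pos hq0 hq1 ht1 _).le

lemma qconn_comm (q t : ℝ) (n m : ℕ) : qconn q t n m = qconn q t m n := by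
  simp only [qconn, mul_comm n m, add_comm n m]
  ring

lemma qconn_zero {q t : ℝ} (hq0 : 0 < q) (hq1 : q < 1) (ht1 : t ≤ 1) (n : ℕ) :
    qconn q t n 0 = 1 := by
  simp [qconn, (qfac_pos hq0 hq1 ht1 n).ne', show qfac q t 0 = 1 from Finset.prod_range_zero _]

lemma qconn_nonneg {q t : ℝ} (hq0 : 0 < q) (hq1 : q < 1) (ht1 : t ≤ 1) (n m : ℕ) :
    0 ≤ qconn q t n m := by
  have h1 := qfac_pos hq0 hq1 ht1 n
  have h2 := qfac_pos hq0 hq1 ht1 m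
  have h3 := qfac_pos hq0 hq1 ht1 (n + m)
  unfold qconn
  positivity

lemma qconn_le {q t : ℝ} (hq0 : 0 < q) (hq1 : q < 1) (ht0 : 0 ≤ t) (ht1 : t ≤ 1) (n m : ℕ) :
    qconn q t n m ≤ q ^ (n * m) := by
  rw [qconn, div_le_iff₀ (qfac_pos hq0 hq1 ht1 _), mul_assoc]
  exact mul_le_mul_of_nonneg_left (qfac_mul_le hq0 hq1 ht0 ht1 n m) (pow_pos hq0 _).le

lemma qconn_transport {q t : ℝ} (hq0 : 0 < q) (hq1 : q < 1) (ht1 : t ≤ 1) {n : ℕ} (hn : 0 < n)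
    (m : ℕ) : qconn q t n (m + 1) * (qden q t (m + 1))⁻¹ =
      qratio q n * (qconn q t n m - qconn q t n (m + 1)) := by
  have h1 := (qden_pos hq0 hq1 ht1 m.succ_pos).ne'
  have h2 : qden q t (n + m + 1) ≠ 0 := (qden_pos hq0 hq1 ht1 (Nat.succ_pos _)).ne'
  have h3 := (qfac_pos hq0 hq1 ht1 (n + m)).ne'
  have h4 : qnum q n ≠ 0 := by linarith [one_le_qnum hq0 hq1 hn]
  have h5 : qden q t (n + m + 1) = qnum q n + q ^ n * qden q t (m + 1) := by
    rw [add_assoc, qden_add hq1]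
  simp only [qconn, qratio, ← add_assoc, qfac_succ, mul_add, pow_add, mul_one]
  field_simp
  rw [h5]
  ring

lemma hasSum_qconn {q t : ℝ} (hq0 : 0 < q) (hq1 : q < 1) (ht0 : 0 ≤ t) (ht1 : t ≤ 1) {n : ℕ}
    (hn : 0 < n) (m : ℕ) :
    HasSum (fun i => qconn q t n (m + 1 + i) * (qden q t (m + 1 + i))⁻¹)
      (qratio q n * qconn q t n m) := by
  rw [hasSum_iff_tendsto_nat_of_nonneg fun i => mul_nonneg (qconn_nonneg hq0 hq1 ht1 _ _)
    (inv_nonneg.2 (qden_pos hq0 hq1 ht1 (by omega)).le)]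
  have key : ∀ k, ∑ i ∈ Finset.range k, qconn q t n (m + 1 + i) * (qden q t (m + 1 + i))⁻¹ =
      qratio q n * (qconn q t n m - qconn q t n (m + k)) := by
    intro k
    have h := Finset.sum_range_sub' (fun i => qconn q t n (m + i)) k
    rw [add_zero] at h
    rw [← h, Finset.mul_sum]
    refine Finset.sum_congr rfl fun i _ => ?_
    rw [show m + 1 + i = m + i + 1 by ring, qconn_transport hq0 hq1 ht1 hn, add_assoc]
  simp only [key]
  have hlim : Tendsto (fun k => qconn q t n (m + k)) atTop (𝓝 0) := by
    refine squeeze_zero (fun k => qconn_nonneg hq0 hq1 ht1 _ _) (fun k => ?_)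
      (tendsto_pow_atTop_nhds_zero_of_lt_one hq0.le hq1)
    refine (qconn_le hq0 hq1 ht0 ht1 _ _).trans (pow_le_pow_of_le_one hq0.le hq1.le ?_)
    nlinarith
  simpa using (tendsto_const_nhds.sub hlim).const_mul (qratio q n)

lemma tsum_qconn {q t : ℝ} (hq0 : 0 < q) (hq1 : q < 1) (ht0 : 0 ≤ t) (ht1 : t ≤ 1) {n : ℕ}
    (hn : 0 < n) (m : ℕ) :
    ∑' i, ENNReal.ofReal (qconn q t n (m + 1 + i)) * ENNReal.ofReal (qden q t (m + 1 + i))⁻¹ =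
      ENNReal.ofReal (qratio q n) * ENNReal.ofReal (qconn q t n m) := by
  have h := hasSum_qconn hq0 hq1 ht0 ht1 hn m
  rw [← ENNReal.ofReal_mul (qratio_nonneg hq0 hq1 n), ← h.tsum_eq, ENNReal.ofReal_tsum_of_nonneg
    (fun i => mul_nonneg (qconn_nonneg hq0 hq1 ht1 _ _)
      (inv_nonneg.2 (qden_pos hq0 hq1 ht1 (by omega)).le)) h.summable]
  exact tsum_congr fun i => (ENNReal.ofReal_mul (qconn_nonneg hq0 hq1 ht1 _ _)).symm

lemma tsum_decTuple_qconn {q t : ℝ} (hq0 : 0 < q) (hq1 : q < 1) (ht0 : 0 ≤ t) (ht1 : t ≤ 1)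
    {n : ℕ} (hn : 0 < n) (r : ℕ) :
    ∑' k : DecTuple r, ENNReal.ofReal (qconn q t n k.head) *
      ∏ j, ENNReal.ofReal (qden q t (k.1 j))⁻¹ = ENNReal.ofReal (qratio q n) ^ r := by
  induction r with
  | zero =>
    have : Unique (DecTuple 0) :=
      ⟨⟨⟨Fin.elim0, fun i => i.elim0, fun i => i.elim0⟩⟩,
        fun k => Subtype.ext (Subsingleton.elim _ _)⟩
    simp [DecTuple.head, qconn_zero hq0 hq1 ht1]
  | succ r ih =>
    rw [DecTuple.tsum_succ, pow_succ', ← ih, ← ENNReal.tsum_mul_left]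
    refine tsum_congr fun k => ?_
    rw [← mul_assoc, ← tsum_qconn hq0 hq1 ht0 ht1 hn, ← ENNReal.tsum_mul_right]
    refine tsum_congr fun i => ?_
    simp only [DecTuple.head_succ, Fin.prod_univ_succ, DecTuple.consEquiv_zero,
      DecTuple.consEquiv_succ, mul_assoc]

/-- The sum formula for generating functions in `t`. -/
lemma tsum_decTuple_qden {q t : ℝ} (hq0 : 0 < q) (hq1 : q < 1) (ht0 : 0 ≤ t) (ht1 : t ≤ 1)
    {r : ℕ} (hr : 0 < r) :
    ∑' k : DecTuple r, ENNReal.ofReal (qratio q k.head) *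
      ∏ j, ENNReal.ofReal (qden q t (k.1 j))⁻¹ =
    ∑' i, ENNReal.ofReal (qratio q (i + 1)) ^ r * ENNReal.ofReal (qden q t (i + 1))⁻¹ := by
  calc _ = ∑' k : DecTuple r, ∑' i, ENNReal.ofReal (qconn q t k.head (i + 1)) *
        ENNReal.ofReal (qden q t (i + 1))⁻¹ * ∏ j, ENNReal.ofReal (qden q t (k.1 j))⁻¹ := by
        refine tsum_congr fun k => ?_
        have hk : 0 < k.head := by
          rw [DecTuple.head, dif_pos hr]
          exact k.2.2 _
        have h := tsum_qconn hq0 hq1 ht0 ht1 hk 0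
        rw [qconn_zero hq0 hq1 ht1, ENNReal.ofReal_one, mul_one] at h
        rw [← h, ENNReal.tsum_mul_right]
        simp only [zero_add, add_comm 1]
    _ = _ := by
        rw [ENNReal.tsum_comm]
        refine tsum_congr fun i => ?_
        rw [← tsum_decTuple_qconn hq0 hq1 ht0 ht1 i.succ_pos r, ← ENNReal.tsum_mul_right]
        refine tsum_congr fun k => ?_
        rw [qconn_comm, mul_right_comm]

lemma tsum_qratio_geometric {q t : ℝ} (hq0 : 0 < q) (hq1 : q < 1) (ht0 : 0 ≤ t) (ht1 : t ≤ 1)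
    {k : ℕ} (hk : 0 < k) :
    ∑' e : ℕ, ENNReal.ofReal t ^ e * ENNReal.ofReal (qratio q k ^ e / qnum q k) =
      ENNReal.ofReal (qden q t k)⁻¹ := by
  have hy := qratio_nonneg hq0 hq1 k
  have hB := one_le_qnum hq0 hq1 hk
  have hlt : t * qratio q k < 1 := by
    have h2 : q ^ k ≤ q := pow_le_of_le_one hq0.le hq1.le hk.ne'
    have h3 := qratio_le hq0 hq1 hk
    have h4 := mul_le_of_le_one_left hy ht1
    linarith
  have hs := (hasSum_geometric_of_lt_one (mul_nonneg ht0 hy) hlt).div_const (qnum q k)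
  have he : (1 - t * qratio q k)⁻¹ / qnum q k = (qden q t k)⁻¹ := by
    rw [div_eq_mul_inv, ← mul_inv]
    congr 1
    simp only [qratio, qden]
    field_simp
  rw [← he, ← hs.tsum_eq, ENNReal.ofReal_tsum_of_nonneg (fun e => by positivity) hs.summable]
  refine tsum_congr fun e => ?_
  rw [← ENNReal.ofReal_pow ht0, ← ENNReal.ofReal_mul (by positivity), mul_pow, mul_div_assoc]

lemma tsum_qratio_pow_lt_top {q t : ℝ} (hq0 : 0 < q) (hq1 : q < 1) (ht1 : t ≤ 1)
    {r : ℕ} (hr : 0 < r) :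
    ∑' i, ENNReal.ofReal (qratio q (i + 1)) ^ r * ENNReal.ofReal (qden q t (i + 1))⁻¹ ≠ ∞ := by
  have hs : Summable fun i : ℕ => q ^ i * (1 - q)⁻¹ :=
    (summable_geometric_of_lt_one hq0.le hq1).mul_right _
  refine ne_top_of_le_ne_top hs.tsum_ofReal_ne_top (ENNReal.tsum_le_tsum fun i => ?_)
  have hy := qratio_nonneg hq0 hq1 (i + 1)
  have h1 := qratio_le hq0 hq1 i.succ_pos
  have h2 : q ^ (i + 1) ≤ q ^ i := pow_le_pow_of_le_one hq0.le hq1.le i.le_succ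
  have h3 : q ^ i ≤ 1 := pow_le_one₀ hq0.le hq1.le
  rw [← ENNReal.ofReal_pow hy, ← ENNReal.ofReal_mul (by positivity)]
  refine ENNReal.ofReal_le_ofReal (mul_le_mul ?_ ?_ ?_ (by positivity))
  · exact (pow_le_of_le_one hy (h1.trans (h2.trans h3)) hr.ne').trans (h1.trans h2)
  · exact inv_anti₀ (sub_pos.2 hq1) (le_qden hq0 hq1 ht1 i.succ_pos)
  · exact inv_nonneg.2 (qden_pos hq0 hq1 ht1 i.succ_pos).le

lemma eq_zero_of_hasSum_pow_zero {d : ℕ → ℝ}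
    (h : ∀ t : ℝ, 0 < t → t ≤ 1 → HasSum (fun n => t ^ n * d n) 0) : d = 0 := by
  suffices H : ∀ n, ∀ m < n, d m = 0 from funext fun m => H (m + 1) m m.lt_succ_self
  intro n
  induction n with
  | zero => exact fun m hm => absurd hm m.not_lt_zero
  | succ n ih =>
    intro m hm
    rcases Nat.lt_succ_iff_lt_or_eq.1 hm with hm | rfl
    · exact ih m hm
    have hd : Summable fun i => |d i| := by
      have := (h 1 one_pos le_rfl).summable.abs
      simpa using this
    have hd' : Summable fun i => |d (i + (m + 1))| :=
      hd.comp_injective (add_left_injective (m + 1))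
    set B := ∑' i, |d (i + (m + 1))|
    have hbound : ∀ t : ℝ, 0 < t → t ≤ 1 → |d m| ≤ t * B := by
      intro t ht0 ht1
      have h1 := (hasSum_nat_add_iff' (m + 1)).2 (h t ht0 ht1)
      rw [Finset.sum_range_succ, Finset.sum_eq_zero fun i hi => by
        rw [ih i (Finset.mem_range.1 hi), mul_zero], zero_add, zero_sub] at h1
      have h2 : |t ^ m * d m| ≤ t ^ (m + 1) * B := by
        rw [← abs_neg, ← Real.norm_eq_abs, ← h1.tsum_eq]
        refine tsum_of_norm_bounded (hd'.hasSum.mul_left (t ^ (m + 1))) fun i => ?_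
        rw [norm_mul, Real.norm_eq_abs, Real.norm_eq_abs, abs_of_pos (pow_pos ht0 _)]
        exact mul_le_mul_of_nonneg_right (pow_le_pow_of_le_one ht0.le ht1 (by omega))
          (abs_nonneg _)
      rw [abs_mul, abs_of_pos (pow_pos ht0 m), pow_succ, mul_assoc] at h2
      exact le_of_mul_le_mul_left h2 (pow_pos ht0 m)
    have hlim : Tendsto (fun t : ℝ => t * B) (𝓝[>] 0) (𝓝 0) := by
      have : Tendsto (fun t : ℝ => t * B) (𝓝 0) (𝓝 (0 * B)) :=
        (continuous_id.mul continuous_const).tendsto 0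
      rw [zero_mul] at this
      exact this.mono_left nhdsWithin_le_nhds
    have hle : |d m| ≤ 0 := ge_of_tendsto hlim <| by
      filter_upwards [Ioc_mem_nhdsGT (zero_lt_one' ℝ)] with t ht
      exact hbound t ht.1 ht.2
    exact abs_nonpos_iff.1 hle

/-- Power series with nonnegative coefficients agreeing on `(0, 1]` have equal coefficients. -/
lemma ENNReal.eq_of_tsum_pow_eq {L R : ℕ → ℝ≥0∞}
    (h : ∀ t : ℝ, 0 < t → t ≤ 1 →
      ∑' n, ENNReal.ofReal t ^ n * L n = ∑' n, ENNReal.ofReal t ^ n * R n)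
    (hR : ∑' n, R n ≠ ∞) : L = R ∧ ∀ n, L n ≠ ∞ := by
  have hL : ∑' n, L n ≠ ∞ := by
    have := h 1 one_pos le_rfl
    simp only [ENNReal.ofReal_one, one_pow, one_mul] at this
    rwa [this]
  have hs : ∀ {F : ℕ → ℝ≥0∞}, ∑' n, F n ≠ ∞ → ∀ t : ℝ, 0 < t → t ≤ 1 →
      HasSum (fun n => t ^ n * (F n).toReal) (∑' n, ENNReal.ofReal t ^ n * F n).toReal := by
    intro F hF t ht0 ht1
    have hle : ∑' n, ENNReal.ofReal t ^ n * F n ≠ ∞ :=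
      ne_top_of_le_ne_top hF (ENNReal.tsum_le_tsum fun n =>
        mul_le_of_le_one_left' (pow_le_one₀ (zero_le) (by simpa using ht1)))
    have := ENNReal.hasSum_toReal hle
    rw [ENNReal.tsum_toReal_eq fun n => ENNReal.ne_top_of_tsum_ne_top hle n]
    simpa [ENNReal.toReal_mul, ENNReal.toReal_pow, ENNReal.toReal_ofReal ht0.le] using this
  have hd := eq_zero_of_hasSum_pow_zero (d := fun n => (L n).toReal - (R n).toReal)
    fun t ht0 ht1 => by
      have := (hs hL t ht0 ht1).sub (hs hR t ht0 ht1)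
      rw [h t ht0 ht1, sub_self] at this
      simpa [mul_sub] using this
  have hfL := ENNReal.ne_top_of_tsum_ne_top hL
  refine ⟨funext fun n => ?_, hfL⟩
  rw [← ENNReal.toReal_eq_toReal_iff' (hfL n) (ENNReal.ne_top_of_tsum_ne_top hR n)]
  exact sub_eq_zero.1 (congrFun hd n)

/-- The shifted multiple `q`-zeta value `ζ*[1+e₁,…,1+e_r]` with values in `[0, ∞]`. -/
noncomputable def qmzvShift (q : ℝ) {r : ℕ} (e : Fin r → ℕ) : ℝ≥0∞ :=
  ∑' k : DecTuple r, ENNReal.ofReal (qratio q k.head) *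
    ∏ j, ENNReal.ofReal (qratio q (k.1 j) ^ e j / qnum q (k.1 j))

lemma qmzv_eq_toReal {q : ℝ} (hq0 : 0 < q) (hq1 : q < 1) {r : ℕ} (hr : 0 < r) (n : Fin r → ℕ)
    (hn : ∀ j, 0 < n j) :
    qmzv q (fun j => if j.val = 0 then n j + 1 else n j) =
      (qmzvShift q fun j => n j - 1).toReal := by
  obtain ⟨r, rfl⟩ := Nat.exists_eq_add_one.2 hr
  rw [qmzvShift, ENNReal.tsum_toReal_eq fun k => ENNReal.mul_ne_top ENNReal.ofReal_ne_top
    (ENNReal.prod_ne_top fun j _ => ENNReal.ofReal_ne_top), qmzv]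
  refine tsum_congr fun k => ?_
  have hf : ∀ j, q ^ ((n j - 1) * k.1 j) / qnum q (k.1 j) ^ n j =
      qratio q (k.1 j) ^ (n j - 1) / qnum q (k.1 j) := fun j => by
    obtain ⟨m, hm⟩ := Nat.exists_eq_add_one.2 (hn j)
    rw [hm, qratio, div_pow, div_div, Nat.add_sub_cancel, ← pow_succ, mul_comm, pow_mul]
  have h0 : q ^ (n 0 * k.1 0) / qnum q (k.1 0) ^ (n 0 + 1) =
      qratio q (k.1 0) * (qratio q (k.1 0) ^ (n 0 - 1) / qnum q (k.1 0)) := by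
    obtain ⟨m, hm⟩ := Nat.exists_eq_add_one.2 (hn 0)
    rw [hm, Nat.add_sub_cancel, ← mul_div_assoc, ← pow_succ', qratio, div_pow, div_div, ← pow_succ,
      mul_comm, pow_mul]
  rw [ENNReal.toReal_mul, ENNReal.toReal_prod, ENNReal.toReal_ofReal (qratio_nonneg hq0 hq1 _)]
  simp only [ENNReal.toReal_ofReal (div_nonneg (pow_nonneg (qratio_nonneg hq0 hq1 _) _)
    (qnum_nonneg hq0 hq1 _))]
  simp only [Fin.prod_univ_succ, Fin.val_zero, if_true, Fin.val_succ, Nat.succ_ne_zero, if_false,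
    Nat.add_sub_cancel, hf, h0]
  rw [mul_assoc]
  rfl

/-- The single `q`-zeta value `ζ*[N]` with values in `[0, ∞]`. -/
noncomputable def qzvShift (q : ℝ) (N : ℕ) : ℝ≥0∞ :=
  ∑' i, ENNReal.ofReal (qratio q (i + 1) ^ N / qnum q (i + 1))

lemma qmzv_one_eq_toReal {q : ℝ} (hq0 : 0 < q) (hq1 : q < 1) (N : ℕ) :
    qmzv q (fun _ : Fin 1 => N + 1) = (qzvShift q N).toReal := by
  have : Unique (DecTuple 0) :=
    ⟨⟨⟨Fin.elim0, fun i => i.elim0, fun i => i.elim0⟩⟩,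
      fun k => Subtype.ext (Subsingleton.elim _ _)⟩
  have he : qzvShift q N = ∑' k : DecTuple 1, ENNReal.ofReal
      (qratio q (k.1 0) ^ N / qnum q (k.1 0)) := by
    rw [DecTuple.tsum_succ, tsum_fintype]
    simp only [Finset.univ_unique, Finset.sum_singleton, qzvShift]
    refine tsum_congr fun i => ?_
    rw [DecTuple.consEquiv_zero]
    simp [DecTuple.head, add_comm]
  rw [he, ENNReal.tsum_toReal_eq fun k => ENNReal.ofReal_ne_top, qmzv]
  refine tsum_congr fun k => ?_
  rw [ENNReal.toReal_ofReal (div_nonneg (pow_nonneg (qratio_nonneg hq0 hq1 _) _)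
    (qnum_nonneg hq0 hq1 _))]
  simp only [Finset.univ_unique, Finset.prod_singleton, Fin.default_eq_zero, Nat.add_sub_cancel]
  rw [qratio, div_pow, div_div, ← pow_succ, mul_comm, pow_mul]

lemma tsum_qmzvShift {q t : ℝ} (hq0 : 0 < q) (hq1 : q < 1) (ht0 : 0 ≤ t) (ht1 : t ≤ 1) (r : ℕ) :
    ∑' M, ENNReal.ofReal t ^ M * ∑' e : {e : Fin r → ℕ // ∑ j, e j = M}, qmzvShift q e.1 =
    ∑' k : DecTuple r, ENNReal.ofReal (qratio q k.head) *
      ∏ j, ENNReal.ofReal (qden q t (k.1 j))⁻¹ := by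
  calc _ = ∑' M, ∑' e : {e : Fin r → ℕ // ∑ j, e j = M},
        ENNReal.ofReal t ^ (∑ j, e.1 j) * qmzvShift q e.1 := by
        refine tsum_congr fun M => ?_
        rw [← ENNReal.tsum_mul_left]
        refine tsum_congr fun e => ?_
        rw [e.2]
    _ = ∑' e : Fin r → ℕ, ENNReal.ofReal t ^ (∑ j, e j) * qmzvShift q e := by
        rw [← (Equiv.sigmaFiberEquiv fun e : Fin r → ℕ => ∑ j, e j).tsum_eq, ENNReal.tsum_sigma']
        rfl
    _ = _ := by
        simp only [qmzvShift, ← ENNReal.tsum_mul_left]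
        rw [ENNReal.tsum_comm]
        refine tsum_congr fun k => ?_
        simp only [← tsum_qratio_geometric hq0 hq1 ht0 ht1 (k.2.2 _)]
        rw [← ENNReal.tsum_fin_pi_prod fun j e => ENNReal.ofReal t ^ e *
          ENNReal.ofReal (qratio q (k.1 j) ^ e / qnum q (k.1 j)), ← ENNReal.tsum_mul_left]
        refine tsum_congr fun e => ?_
        rw [Finset.prod_mul_distrib, Finset.prod_pow_eq_pow_sum, mul_left_comm]

lemma tsum_qzvShift {q t : ℝ} (hq0 : 0 < q) (hq1 : q < 1) (ht0 : 0 ≤ t) (ht1 : t ≤ 1) (r : ℕ) :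
    ∑' M, ENNReal.ofReal t ^ M * qzvShift q (M + r) =
    ∑' i, ENNReal.ofReal (qratio q (i + 1)) ^ r * ENNReal.ofReal (qden q t (i + 1))⁻¹ := by
  simp only [qzvShift, ← ENNReal.tsum_mul_left]
  rw [ENNReal.tsum_comm]
  refine tsum_congr fun i => ?_
  have hy := qratio_nonneg hq0 hq1 (i + 1)
  rw [← tsum_qratio_geometric hq0 hq1 ht0 ht1 i.succ_pos, ← ENNReal.tsum_mul_left]
  refine tsum_congr fun M => ?_
  rw [pow_add, mul_comm (qratio q (i + 1) ^ M), mul_div_assoc,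
    ENNReal.ofReal_mul (pow_nonneg hy r), ENNReal.ofReal_pow hy, mul_left_comm]

/-- Lowering all parts of a composition by one. -/
def compositionPredEquiv {N r : ℕ} (hN : r ≤ N) :
    {n : Fin r → ℕ // (∀ j, 0 < n j) ∧ (∑ j, n j) = N} ≃
      {e : Fin r → ℕ // ∑ j, e j = N - r} where
  toFun n := ⟨fun j => n.1 j - 1, by
    have h : ∑ j, (n.1 j - 1 + 1) = N :=
      (Finset.sum_congr rfl fun j _ => Nat.sub_add_cancel (n.2.1 j)).trans n.2.2
    simp only [Finset.sum_add_distrib, Finset.sum_const, Finset.card_univ, Fintype.card_fin, smul_eq_mul, mul_one] at h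
    exact Nat.eq_sub_of_add_eq h⟩
  invFun e := ⟨fun j => e.1 j + 1, fun j => Nat.succ_pos _, by
    rw [Finset.sum_add_distrib, e.2]
    simp only [Finset.sum_const, Finset.card_univ, Fintype.card_fin, smul_eq_mul, mul_one]
    omega⟩
  left_inv n := Subtype.ext (funext fun j => Nat.sub_add_cancel (n.2.1 j))
  right_inv e := Subtype.ext (funext fun j => Nat.add_sub_cancel _ _)

/-- The q-sum formula: the sum of shifted multiple q-zeta values
`ζ*[n₁,…,n_r] = ζ[1+n₁,n₂,…,n_r]` over all compositions of `N` into `r`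
positive parts equals `ζ*[N] = ζ[1+N]`. -/
theorem q_sum_formula (q : ℝ) (hq0 : 0 < q) (hq1 : q < 1)
    (N r : ℕ) (hr : 0 < r) (hN : r ≤ N) :
    (∑' n : {n : Fin r → ℕ // (∀ j, 0 < n j) ∧ (∑ j, n j) = N},
      qmzv q (fun j => if j.val = 0 then n.1 j + 1 else n.1 j))
    = qmzv q (fun _ : Fin 1 => N + 1) := by
  obtain ⟨hLR, hfin⟩ := ENNReal.eq_of_tsum_pow_eq
    (L := fun M => ∑' e : {e : Fin r → ℕ // ∑ j, e j = M}, qmzvShift q e.1)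
    (R := fun M => qzvShift q (M + r))
    (fun t ht0 ht1 => by
      rw [tsum_qmzvShift hq0 hq1 ht0.le ht1, tsum_qzvShift hq0 hq1 ht0.le ht1,
        tsum_decTuple_qden hq0 hq1 ht0.le ht1 hr])
    (by
      have h := tsum_qratio_pow_lt_top hq0 hq1 le_rfl hr
      rw [← tsum_qzvShift hq0 hq1 zero_le_one le_rfl] at h
      simpa using h)
  have hM := congrFun hLR (N - r)
  simp only [Nat.sub_add_cancel hN] at hM
  rw [qmzv_one_eq_toReal hq0 hq1, ← hM,
    ENNReal.tsum_toReal_eq (ENNReal.ne_top_of_tsum_ne_top (hfin (N - r))),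
    ← (compositionPredEquiv hN).tsum_eq]
  exact tsum_congr fun n => qmzv_eq_toReal hq0 hq1 hr n.1 n.2.1
end

section
/- Let N and r be positive integers with N ≥ r. Then the sum of the shifted multiple zeta values ζ*(n_1,n_2,...,n_r) = ζ(1+n_1,n_2,...,n_r), taken over all tuples of positive integers (n_1,...,n_r) with n_1+n_2+...+n_r = N, equals ζ*(N) = ζ(1+N). -/
/-- The multiple zeta value `ζ(n₁,…,n_r)`, summed over all strictly
decreasing tuples of positive integers `k₁ > k₂ > ⋯ > k_r > 0`. -/
noncomputable def mzv {r : ℕ} (n : Fin r → ℕ) : ℝ :=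
  ∑' k : {k : Fin r → ℕ // (∀ i j : Fin r, i < j → k j < k i) ∧ ∀ j, 0 < k j},
    ∏ j : Fin r, (1 : ℝ) / (k.1 j : ℝ) ^ (n j)

open Finset Filter Topology

/-- The summand `(1 - x + y)_k / (1 + m - x)_{k+1}` of the telescoping sums. -/
noncomputable def telescoper (x y : ℝ) (m k : ℕ) : ℝ :=
  (∏ i ∈ range k, ((i : ℝ) + 1 - x + y) / (i + 1 + m - x)) / (k + 1 + m - x)

section Telescoping

variable {x y : ℝ}

lemma telescoper_zero (m : ℕ) : telescoper x y m 0 = 1 / (m + 1 - x) := by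
  simp [telescoper, add_comm]

lemma telescoper_succ (hx : x < 1) (m k : ℕ) :
    telescoper x y m (k + 1) = telescoper x y m k * ((k + 1 - x + y) / (k + 2 + m - x)) := by
  have hk : (0 : ℝ) ≤ k := k.cast_nonneg
  have hm : (0 : ℝ) ≤ m := m.cast_nonneg
  have h1 : (k : ℝ) + 1 + m - x ≠ 0 := by linarith
  have h2 : (k : ℝ) + 2 + m - x ≠ 0 := by linarith
  have h3 : (k : ℝ) + 1 + 1 + m - x ≠ 0 := by linarith
  simp only [telescoper, prod_range_succ, Nat.cast_add, Nat.cast_one]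
  field_simp
  ring

lemma telescoper_nonneg (hx : x < 1) (hy : 0 ≤ y) (m k : ℕ) : 0 ≤ telescoper x y m k := by
  have hk : (0 : ℝ) ≤ k := k.cast_nonneg
  have hm : (0 : ℝ) ≤ m := m.cast_nonneg
  refine div_nonneg (prod_nonneg fun i _ => ?_) (by linarith)
  have hi : (0 : ℝ) ≤ i := i.cast_nonneg
  exact div_nonneg (by linarith) (by linarith)

lemma telescoper_succ_left (hx : x < 1) (m k : ℕ) :
    telescoper x y (m + 1) k = telescoper x y m k * ((m + 1 - x) / (k + 2 + m - x)) := by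
  have hm : (0 : ℝ) ≤ m := m.cast_nonneg
  induction k with
  | zero =>
    have h1 : (m : ℝ) + 1 - x ≠ 0 := by linarith
    simp only [telescoper_zero]
    push_cast
    field_simp
    ring
  | succ k ih =>
    have hk : (0 : ℝ) ≤ k := k.cast_nonneg
    have h1 : (k : ℝ) + 2 + m - x ≠ 0 := by linarith
    have h2 : (k : ℝ) + 3 + m - x ≠ 0 := by linarith
    rw [telescoper_succ hx, telescoper_succ hx, ih]
    push_cast
    rw [show (k : ℝ) + 2 + (m + 1) - x = k + 3 + m - x by ring,
      show (k : ℝ) + 1 + 2 + m - x = k + 3 + m - x by ring]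
    field_simp

lemma telescoper_sub_succ (hx : x < 1) (m k : ℕ) :
    telescoper x y m k - telescoper x y m (k + 1) =
      (m + 1 - y) * (telescoper x y m k / (k + 2 + m - x)) := by
  have hk : (0 : ℝ) ≤ k := k.cast_nonneg
  have hm : (0 : ℝ) ≤ m := m.cast_nonneg
  have h1 : (k : ℝ) + 2 + m - x ≠ 0 := by linarith
  rw [telescoper_succ hx]
  field_simp
  ring

lemma telescoper_div_sub (hx : x < 1) (m k : ℕ) :
    telescoper x y m k / (k + 1) - telescoper x y (m + 1) k / (k + 1) =
      telescoper x y m k / (k + 2 + m - x) := by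
  have hk : (0 : ℝ) ≤ k := k.cast_nonneg
  have hm : (0 : ℝ) ≤ m := m.cast_nonneg
  have h1 : (k : ℝ) + 2 + m - x ≠ 0 := by linarith
  rw [telescoper_succ_left hx]
  field_simp
  ring

lemma telescoper_succ_left_le (hx0 : 0 ≤ x) (hx : x < 1) (hy : 0 ≤ y) (m k : ℕ) :
    telescoper x y (m + 1) k ≤ telescoper x y m k * ((m + 1) / (m + 2)) := by
  have hk : (0 : ℝ) ≤ k := k.cast_nonneg
  have hm : (0 : ℝ) ≤ m := m.cast_nonneg
  rw [telescoper_succ_left hx]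
  refine mul_le_mul_of_nonneg_left ?_ (telescoper_nonneg hx hy m k)
  rw [div_le_div_iff₀ (by linarith) (by linarith)]
  nlinarith

lemma telescoper_sq_mul_le (hx0 : 0 ≤ x) (hx : x ≤ 1 / 4) (hy0 : 0 ≤ y) (hy : y ≤ 1 / 4)
    (m k : ℕ) : telescoper x y m k ^ 2 * (k + 1) ≤ 2 := by
  have hm : (0 : ℝ) ≤ m := m.cast_nonneg
  induction k with
  | zero =>
    rw [telescoper_zero]
    have : 1 / ((m : ℝ) + 1 - x) ≤ 4 / 3 := by
      rw [div_le_div_iff₀ (by linarith) (by norm_num)]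
      linarith
    have h0 : 0 ≤ 1 / ((m : ℝ) + 1 - x) := div_nonneg zero_le_one (by linarith)
    simp only [Nat.cast_zero, zero_add, mul_one]
    nlinarith
  | succ k ih =>
    have hk : (0 : ℝ) ≤ k := k.cast_nonneg
    refine le_trans ?_ ih
    rw [telescoper_succ (by linarith), mul_pow, mul_assoc]
    refine mul_le_mul_of_nonneg_left ?_ (sq_nonneg _)
    have h : ((k : ℝ) + 1 - x + y) / (k + 2 + m - x) ≤ (k + 5 / 4) / (k + 2) := by
      rw [div_le_div_iff₀ (by linarith) (by linarith)]
      nlinarith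
    have h0 : 0 ≤ ((k : ℝ) + 1 - x + y) / (k + 2 + m - x) :=
      div_nonneg (by linarith) (by linarith)
    calc (((k : ℝ) + 1 - x + y) / (k + 2 + m - x)) ^ 2 * (((k + 1 : ℕ) : ℝ) + 1)
        ≤ (((k : ℝ) + 5 / 4) / (k + 2)) ^ 2 * (k + 2) := by
          push_cast
          rw [show (k : ℝ) + 1 + 1 = k + 2 by ring]
          gcongr
      _ ≤ (k : ℝ) + 1 := by
          rw [div_pow, div_mul_eq_mul_div, div_le_iff₀ (by positivity)]
          nlinarith

lemma tendsto_telescoper (hx0 : 0 ≤ x) (hx : x ≤ 1 / 4) (hy0 : 0 ≤ y) (hy : y ≤ 1 / 4) (m : ℕ) :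
    Tendsto (telescoper x y m) atTop (𝓝 0) := by
  have hsq : Tendsto (fun k => telescoper x y m k ^ 2) atTop (𝓝 0) := by
    have h2 : Tendsto (fun k : ℕ => (2 : ℝ) * (1 / ((k : ℝ) + 1))) atTop (𝓝 0) := by
      simpa using tendsto_one_div_add_atTop_nhds_zero_nat.const_mul (2 : ℝ)
    refine squeeze_zero (fun _ => sq_nonneg _) (fun k => ?_) h2
    rw [mul_one_div, le_div_iff₀ (by positivity)]
    exact telescoper_sq_mul_le hx0 hx hy0 hy m k
  have := hsq.sqrt
  simpa [Real.sqrt_sq (telescoper_nonneg (by linarith : x < 1) hy0 _ _)] using this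

lemma hasSum_telescoper_div (hx0 : 0 ≤ x) (hx : x ≤ 1 / 4) (hy0 : 0 ≤ y) (hy : y ≤ 1 / 4)
    (m : ℕ) : HasSum (fun k : ℕ => telescoper x y m k / (k + 2 + m - x))
      (1 / ((m + 1 - x) * (m + 1 - y))) := by
  have hm : (0 : ℝ) ≤ m := m.cast_nonneg
  have h1 : (m : ℝ) + 1 - y ≠ 0 := by linarith
  have h2 : (m : ℝ) + 1 - x ≠ 0 := by linarith
  rw [hasSum_iff_tendsto_nat_of_nonneg]
  · have h : ∀ n, ∑ k ∈ range n, telescoper x y m k / (k + 2 + m - x) =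
        (1 / (m + 1 - x) - telescoper x y m n) / (m + 1 - y) := by
      intro n
      rw [← telescoper_zero (y := y), ← sum_range_sub', eq_div_iff h1, sum_mul]
      refine sum_congr rfl fun k _ => ?_
      rw [telescoper_sub_succ (by linarith)]
      ring
    simp only [h]
    have := ((tendsto_telescoper hx0 hx hy0 hy m).const_sub (1 / ((m : ℝ) + 1 - x))).div_const
      ((m : ℝ) + 1 - y)
    rwa [sub_zero, div_div] at this
  · intro k
    have hk : (0 : ℝ) ≤ k := k.cast_nonneg
    exact div_nonneg (telescoper_nonneg (by linarith) hy0 _ _) (by linarith)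

lemma summable_telescoper (hx0 : 0 ≤ x) (hx : x ≤ 1 / 4) (hy0 : 0 ≤ y) (hy : y ≤ 1 / 4)
    (m : ℕ) : Summable (fun k : ℕ => telescoper x y m k / (k + 1)) := by
  have hm : (0 : ℝ) ≤ m := m.cast_nonneg
  refine Summable.of_nonneg_of_le (fun k => ?_) (fun k => ?_)
    ((hasSum_telescoper_div hx0 hx hy0 hy m).summable.mul_left ((m : ℝ) + 2))
  · exact div_nonneg (telescoper_nonneg (by linarith) hy0 _ _) (by positivity)
  · have hk : (0 : ℝ) ≤ k := k.cast_nonneg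
    rw [div_eq_mul_one_div, mul_comm ((m : ℝ) + 2), div_mul_eq_mul_div, mul_div_assoc]
    refine mul_le_mul_of_nonneg_left ?_ (telescoper_nonneg (by linarith) hy0 _ _)
    rw [div_le_div_iff₀ (by positivity) (by linarith)]
    nlinarith

/-- The generating function form of the sum formula. -/
lemma hasSum_tsum_telescoper (hx0 : 0 ≤ x) (hx : x ≤ 1 / 4) (hy0 : 0 ≤ y) (hy : y ≤ 1 / 4) :
    HasSum (fun m : ℕ => 1 / (((m : ℝ) + 1 - x) * (m + 1 - y)))
      (∑' k : ℕ, telescoper x y 0 k / (k + 1)) := by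
  have hs := summable_telescoper hx0 hx hy0 hy
  set C : ℕ → ℝ := fun m => ∑' k : ℕ, telescoper x y m k / (k + 1) with hC
  have hnn : ∀ m, 0 ≤ C m := fun m => tsum_nonneg fun k =>
    div_nonneg (telescoper_nonneg (by linarith) hy0 _ _) (by positivity)
  have hle : ∀ m, C m ≤ C 0 * (1 / ((m : ℝ) + 1)) := by
    intro m
    induction m with
    | zero => simp
    | succ m ih =>
      have h : C (m + 1) ≤ C m * ((m + 1) / (m + 2)) := by
        rw [hC, ← tsum_mul_right]
        refine (hs (m + 1)).tsum_le_tsum (fun k => ?_) ((hs m).mul_right _)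
        rw [div_mul_eq_mul_div]
        gcongr
        exact telescoper_succ_left_le hx0 (by linarith) hy0 m k
      refine h.trans ((mul_le_mul_of_nonneg_right ih (by positivity)).trans_eq ?_)
      push_cast
      field_simp
      ring
  have hlim : Tendsto C atTop (𝓝 0) := by
    refine squeeze_zero hnn hle ?_
    simpa using tendsto_one_div_add_atTop_nhds_zero_nat.const_mul (C 0)
  rw [hasSum_iff_tendsto_nat_of_nonneg]
  · have h : ∀ n, ∑ m ∈ range n, 1 / (((m : ℝ) + 1 - x) * (m + 1 - y)) = C 0 - C n := by
      intro n
      rw [← sum_range_sub']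
      refine sum_congr rfl fun m _ => ?_
      rw [← (hasSum_telescoper_div hx0 hx hy0 hy m).tsum_eq, hC]
      rw [← (hs m).tsum_sub (hs (m + 1))]
      exact tsum_congr fun k => (telescoper_div_sub (by linarith) m k).symm
    simp only [h]
    simpa using hlim.const_sub (C 0)
  · intro m
    have hm : (0 : ℝ) ≤ m := m.cast_nonneg
    exact div_nonneg zero_le_one (mul_nonneg (by linarith) (by linarith))

end Telescoping

section PowerSeriesExpansion

lemma HasSum.of_eq {ι : Type*} {f g : ι → ℝ} {a b : ℝ} (h : HasSum f a) (hfg : ∀ i, g i = f i)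
    (hab : b = a) : HasSum g b := by
  rwa [hab, funext hfg]

lemma eq_zero_of_hasSum_mul_pow {f : ℕ → ℝ} {ε : ℝ} (hε : 0 < ε)
    (hf : ∀ x, 0 ≤ x → x ≤ ε → HasSum (fun n => f n * x ^ n) 0) (n : ℕ) : f n = 0 := by
  induction n using Nat.strong_induction_on with
  | _ n ih =>
  have hsum : Summable fun i => |f (i + n)| * ε ^ i := by
    have h1 := ((summable_nat_add_iff n).2 (hf ε hε.le le_rfl).summable.abs).mul_right ((ε ^ n)⁻¹)
    refine h1.congr fun i => ?_
    rw [abs_mul, abs_pow, abs_of_pos hε, pow_add]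
    field_simp
  set S := ∑' i, |f (i + 1 + n)| * ε ^ (i + 1) with hS
  have hS' : Summable fun i => |f (i + 1 + n)| * ε ^ (i + 1) :=
    (summable_nat_add_iff (f := fun i => |f (i + n)| * ε ^ i) 1).2 hsum
  have key : ∀ x, 0 < x → x ≤ ε → |f n| ≤ x / ε * S := by
    intro x hx hxε
    have h0 : HasSum (fun i => f (i + n) * x ^ i) 0 := by
      have h1 := (hasSum_nat_add_iff' n).2 (hf x hx.le hxε)
      rw [sum_eq_zero (fun i hi => by rw [ih i (mem_range.1 hi), zero_mul]), sub_zero] at h1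
      have h2 := h1.mul_right ((x ^ n)⁻¹)
      rw [zero_mul] at h2
      refine h2.of_eq (fun i => ?_) rfl
      rw [pow_add]
      field_simp
    have h1 := (hasSum_nat_add_iff' 1).2 h0
    simp only [range_one, sum_singleton, zero_add, pow_zero, mul_one, zero_sub] at h1
    rw [← abs_neg, ← h1.tsum_eq, hS, ← tsum_mul_left, ← Real.norm_eq_abs]
    refine tsum_of_norm_bounded (hS'.mul_left (x / ε)).hasSum fun i => ?_
    rw [Real.norm_eq_abs, abs_mul, abs_pow, abs_of_pos hx]
    have : x ^ (i + 1) ≤ x / ε * ε ^ (i + 1) := by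
      have h3 : x ^ i ≤ ε ^ i := pow_le_pow_left₀ hx.le hxε i
      rw [pow_succ, pow_succ]
      calc x ^ i * x ≤ ε ^ i * x := mul_le_mul_of_nonneg_right h3 hx.le
        _ = x / ε * (ε ^ i * ε) := by field_simp
    calc |f (i + 1 + n)| * x ^ (i + 1) ≤ |f (i + 1 + n)| * (x / ε * ε ^ (i + 1)) :=
          mul_le_mul_of_nonneg_left this (abs_nonneg _)
      _ = _ := by ring
  have hlim : Tendsto (fun x => x / ε * S) (𝓝[>] 0) (𝓝 0) := by
    have : Tendsto (fun x : ℝ => x / ε * S) (𝓝 0) (𝓝 (0 / ε * S)) :=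
      (tendsto_id.div_const ε).mul_const S
    rw [zero_div, zero_mul] at this
    exact this.mono_left nhdsWithin_le_nhds
  have : |f n| ≤ 0 := by
    refine ge_of_tendsto hlim ?_
    filter_upwards [Ioc_mem_nhdsGT hε] with x hx using key x hx.1 hx.2
  exact abs_nonpos_iff.1 this

lemma eq_of_hasSum_mul_pow {f g : ℕ → ℝ} {F : ℝ → ℝ} {ε : ℝ} (hε : 0 < ε)
    (hf : ∀ x, 0 ≤ x → x ≤ ε → HasSum (fun n => f n * x ^ n) (F x))
    (hg : ∀ x, 0 ≤ x → x ≤ ε → HasSum (fun n => g n * x ^ n) (F x)) (n : ℕ) : f n = g n := by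
  refine sub_eq_zero.1 (eq_zero_of_hasSum_mul_pow (f := fun n => f n - g n) hε
    (fun x hx hxε => ?_) n)
  simpa [sub_mul] using (hf x hx hxε).sub (hg x hx hxε)

lemma summable_right_of_hasSum_mul_pow {A : ℕ × ℕ → ℝ} {x y F : ℝ} (hx : 0 < x)
    (hA : HasSum (fun p : ℕ × ℕ => A p * (x ^ p.1 * y ^ p.2)) F) (a : ℕ) :
    Summable fun b => A (a, b) * y ^ b := by
  refine ((hA.summable.prod_factor a).mul_right ((x ^ a)⁻¹)).congr fun b => ?_
  field_simp

lemma eq_of_hasSum_mul_pow_mul_pow {A B : ℕ × ℕ → ℝ} {F : ℝ → ℝ → ℝ} {ε : ℝ} (hε : 0 < ε)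
    (hA : ∀ x y, 0 ≤ x → x ≤ ε → 0 ≤ y → y ≤ ε →
      HasSum (fun p : ℕ × ℕ => A p * (x ^ p.1 * y ^ p.2)) (F x y))
    (hB : ∀ x y, 0 ≤ x → x ≤ ε → 0 ≤ y → y ≤ ε →
      HasSum (fun p : ℕ × ℕ => B p * (x ^ p.1 * y ^ p.2)) (F x y)) (p : ℕ × ℕ) : A p = B p := by
  have iter : ∀ C : ℕ × ℕ → ℝ, (∀ x y, 0 ≤ x → x ≤ ε → 0 ≤ y → y ≤ ε →
      HasSum (fun p : ℕ × ℕ => C p * (x ^ p.1 * y ^ p.2)) (F x y)) →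
      ∀ x y, 0 ≤ x → x ≤ ε → 0 ≤ y → y ≤ ε →
      HasSum (fun a => (∑' b, C (a, b) * y ^ b) * x ^ a) (F x y) := by
    intro C hC x y hx hxε hy hyε
    refine (hC x y hx hxε hy hyε).prod_fiberwise fun a => ?_
    exact ((summable_right_of_hasSum_mul_pow hε
      (hC ε y hε.le le_rfl hy hyε) a).hasSum.mul_right (x ^ a)).of_eq (fun b => by ring) rfl
  refine eq_of_hasSum_mul_pow (f := fun b => A (p.1, b)) (g := fun b => B (p.1, b))
    (F := fun y => ∑' b, A (p.1, b) * y ^ b) hε (fun y hy hyε => ?_) (fun y hy hyε => ?_) p.2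
  · exact (summable_right_of_hasSum_mul_pow hε (hA ε y hε.le le_rfl hy hyε) p.1).hasSum
  · rw [eq_of_hasSum_mul_pow (f := fun a => ∑' b, A (a, b) * y ^ b)
      (g := fun a => ∑' b, B (a, b) * y ^ b) hε (fun x hx hxε => iter A hA x y hx hxε hy hyε)
      (fun x hx hxε => iter B hB x y hx hxε hy hyε) p.1]
    exact (summable_right_of_hasSum_mul_pow hε (hB ε y hε.le le_rfl hy hyε) p.1).hasSum

lemma hasSum_swap_of_nonneg {α β : Type*} {c : α → β → ℝ} {T : α → ℝ} {F : ℝ}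
    (hc : ∀ k p, 0 ≤ c k p) (hT : ∀ k, HasSum (c k) (T k)) (hF : HasSum T F) :
    (∀ p, Summable fun k => c k p) ∧ HasSum (fun p => ∑' k, c k p) F := by
  have hs : Summable fun q : α × β => c q.1 q.2 := by
    rw [summable_prod_of_nonneg fun q => hc _ _]
    refine ⟨fun k => (hT k).summable, ?_⟩
    simpa only [(hT _).tsum_eq] using hF.summable
  have hF' : HasSum (fun q : α × β => c q.1 q.2) F := by
    rw [← (hs.hasSum.prod_fiberwise hT).unique hF]
    exact hs.hasSum
  have hF'' : HasSum (fun q : β × α => c q.2 q.1) F :=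
    (Equiv.prodComm β α).hasSum_iff.2 hF'
  have hcol : ∀ p, Summable fun k => c k p := fun p => hF''.summable.prod_factor p
  exact ⟨hcol, hF''.prod_fiberwise fun p => (hcol p).hasSum⟩

lemma hasSum_tsum_mul_pow_mul_pow {c : ℕ → ℕ × ℕ → ℝ} {T : ℕ → ℝ} {x y F : ℝ}
    (hx : 0 ≤ x) (hy : 0 ≤ y) (hc : ∀ k p, 0 ≤ c k p)
    (hT : ∀ k, HasSum (fun p => c k p * (x ^ p.1 * y ^ p.2)) (T k)) (hF : HasSum T F) :
    HasSum (fun p : ℕ × ℕ => (∑' k, c k p) * (x ^ p.1 * y ^ p.2)) F := by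
  simpa only [tsum_mul_right] using (hasSum_swap_of_nonneg
    (fun k p => mul_nonneg (hc k p) (by positivity)) hT hF).2

lemma summable_of_hasSum_mul_pow_mul_pow {c : ℕ → ℕ × ℕ → ℝ} {T : ℕ → ℝ} {x y F : ℝ}
    (hx : 0 < x) (hy : 0 < y) (hc : ∀ k p, 0 ≤ c k p)
    (hT : ∀ k, HasSum (fun p => c k p * (x ^ p.1 * y ^ p.2)) (T k)) (hF : HasSum T F)
    (p : ℕ × ℕ) : Summable fun k => c k p :=
  (summable_mul_right_iff (by positivity)).1 ((hasSum_swap_of_nonneg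
    (fun k p => mul_nonneg (hc k p) (by positivity)) hT hF).1 p)

/-- The expansion of `1 / (j + 1 - X)` as a power series in `X`. -/
noncomputable def recipSeries (j : ℕ) : PowerSeries ℝ :=
  PowerSeries.mk fun a => 1 / ((j : ℝ) + 1) ^ (a + 1)

lemma hasSum_coeff_recipSeries {x : ℝ} (hx0 : 0 ≤ x) (hx : x < 1) (j : ℕ) :
    HasSum (fun a => PowerSeries.coeff a (recipSeries j) * x ^ a) (1 / (j + 1 - x)) := by
  have hj : (0 : ℝ) ≤ j := j.cast_nonneg
  have h := (hasSum_geometric_of_lt_one (r := x / (j + 1)) (by positivity)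
    ((div_lt_one (by positivity)).2 (by linarith))).mul_left (1 / ((j : ℝ) + 1))
  refine h.of_eq (fun a => ?_) ?_
  · simp only [recipSeries, PowerSeries.coeff_mk, pow_succ, div_pow]
    field_simp
  · have : (j : ℝ) + 1 - x ≠ 0 := by linarith
    field_simp

lemma hasSum_coeff_mul {P Q : PowerSeries ℝ} {x p q : ℝ}
    (hP : HasSum (fun a => PowerSeries.coeff a P * x ^ a) p)
    (hQ : HasSum (fun a => PowerSeries.coeff a Q * x ^ a) q) :
    HasSum (fun a => PowerSeries.coeff a (P * Q) * x ^ a) (p * q) := by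
  have h : ∀ a, PowerSeries.coeff a (P * Q) * x ^ a = ∑ kl ∈ antidiagonal a,
      (PowerSeries.coeff kl.1 P * x ^ kl.1) * (PowerSeries.coeff kl.2 Q * x ^ kl.2) := by
    intro a
    rw [PowerSeries.coeff_mul, sum_mul]
    refine sum_congr rfl fun kl hkl => ?_
    rw [← mem_antidiagonal.1 hkl, pow_add]
    ring
  simp only [h]
  rw [← hP.tsum_eq, ← hQ.tsum_eq, tsum_mul_tsum_eq_tsum_sum_antidiagonal_of_summable_norm
    hP.summable.norm hQ.summable.norm]
  exact (summable_norm_sum_mul_antidiagonal_of_summable_norm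
    hP.summable.norm hQ.summable.norm).of_norm.hasSum

lemma hasSum_coeff_prod_recipSeries {x : ℝ} (hx0 : 0 ≤ x) (hx : x < 1) (s : Finset ℕ) :
    HasSum (fun a => PowerSeries.coeff a (∏ j ∈ s, recipSeries j) * x ^ a)
      (∏ j ∈ s, 1 / ((j : ℝ) + 1 - x)) := by
  induction s using Finset.induction_on with
  | empty =>
    simp only [prod_empty]
    refine (hasSum_ite_eq 0 (1 : ℝ)).of_eq (fun a => ?_) rfl
    rw [PowerSeries.coeff_one]
    split_ifs with h <;> simp [h]
  | insert j s hj ih =>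
    rw [prod_insert hj, prod_insert hj]
    exact hasSum_coeff_mul (hasSum_coeff_recipSeries hx0 hx j) ih

lemma coeff_prod_recipSeries_nonneg (s : Finset ℕ) (a : ℕ) :
    0 ≤ PowerSeries.coeff a (∏ j ∈ s, recipSeries j) := by
  rw [PowerSeries.coeff_prod]
  refine sum_nonneg fun l _ => prod_nonneg fun j _ => ?_
  rw [recipSeries, PowerSeries.coeff_mk]
  positivity

/-- The part of the sum of all `ζ*(n₁,…,n_r)` of depth `r = p.2 + 1` and weight
`p.1 + r` in which the largest summation index is `k + 1`. -/
noncomputable def outerTerm (k : ℕ) (p : ℕ × ℕ) : ℝ :=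
  1 / ((k : ℝ) + 1) * ∑ s ∈ powersetCard p.2 (range k),
    PowerSeries.coeff p.1 (∏ j ∈ insert k s, recipSeries j)

lemma outerTerm_nonneg (k : ℕ) (p : ℕ × ℕ) : 0 ≤ outerTerm k p :=
  mul_nonneg (by positivity) (sum_nonneg fun _ _ => coeff_prod_recipSeries_nonneg _ _)

lemma hasSum_outerTerm {x : ℝ} (hx0 : 0 ≤ x) (hx : x < 1) (y : ℝ) (k : ℕ) :
    HasSum (fun p => outerTerm k p * (x ^ p.1 * y ^ p.2)) (telescoper x y 0 k / (k + 1)) := by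
  have hs : ∀ s ∈ (range k).powerset, HasSum (fun p : ℕ × ℕ =>
      if #s = p.2 then PowerSeries.coeff p.1 (∏ j ∈ insert k s, recipSeries j) *
        (x ^ p.1 * y ^ p.2) else 0)
      ((∏ j ∈ insert k s, 1 / ((j : ℝ) + 1 - x)) * y ^ #s) := by
    intro s _
    have hinj : Function.Injective fun a : ℕ => (a, #s) := fun a b h => (Prod.ext_iff.1 h).1
    rw [← hinj.hasSum_iff]
    · refine ((hasSum_coeff_prod_recipSeries hx0 hx (insert k s)).mul_right (y ^ #s)).of_eq
        (fun a => ?_) rfl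
      simp [mul_assoc]
    · rintro ⟨a, b⟩ hab
      refine if_neg fun h => hab ⟨a, ?_⟩
      simpa using h
  have h := (hasSum_sum hs).mul_left (1 / ((k : ℝ) + 1))
  refine h.of_eq (fun p => ?_) ?_
  · rw [outerTerm, mul_assoc, sum_mul, powersetCard_eq_filter, sum_filter]
  · rw [telescoper, div_eq_mul_one_div, mul_comm]
    congr 1
    have hprod : ∏ i ∈ range k, ((i : ℝ) + 1 - x + y) / (i + 1 + (0 : ℕ) - x) =
        ∑ s ∈ (range k).powerset, ∏ j ∈ s, y * (1 / ((j : ℝ) + 1 - x)) := by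
      rw [← prod_one_add]
      refine prod_congr rfl fun i _ => ?_
      have hi : (0 : ℝ) ≤ i := i.cast_nonneg
      have : (i : ℝ) + 1 - x ≠ 0 := by linarith
      push_cast
      rw [add_zero]
      field_simp
    rw [hprod, sum_div]
    refine sum_congr rfl fun s hs => ?_
    have hk : k ∉ s := fun h => by simpa using mem_powerset.1 hs h
    rw [prod_insert hk, prod_mul_distrib, prod_const]
    push_cast
    rw [add_zero]
    ring

lemma summable_outerTerm (p : ℕ × ℕ) : Summable fun k => outerTerm k p :=
  summable_of_hasSum_mul_pow_mul_pow (x := 1 / 4) (y := 1 / 4) (by norm_num) (by norm_num)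
    outerTerm_nonneg (hasSum_outerTerm (by norm_num) (by norm_num) _)
    (summable_telescoper (by norm_num) (by norm_num) (by norm_num) (by norm_num) 0).hasSum p

lemma hasSum_zeta_expansion {x y : ℝ} (hx0 : 0 ≤ x) (hx : x < 1) (hy0 : 0 ≤ y) (hy : y < 1)
    (m : ℕ) : HasSum (fun p : ℕ × ℕ => 1 / ((m : ℝ) + 1) ^ (p.1 + p.2 + 2) *
      (x ^ p.1 * y ^ p.2)) (1 / ((m + 1 - x) * (m + 1 - y))) := by
  have h1 := hasSum_coeff_recipSeries hx0 hx m
  have h2 := hasSum_coeff_recipSeries hy0 hy m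
  have h := h1.mul h2 (summable_mul_of_summable_norm h1.summable.norm h2.summable.norm)
  refine h.of_eq (fun p => ?_) ?_
  · simp only [recipSeries, PowerSeries.coeff_mk]
    field_simp
    ring
  · rw [one_div_mul_one_div]

lemma tsum_outerTerm (p : ℕ × ℕ) :
    ∑' k, outerTerm k p = ∑' m : ℕ, 1 / ((m : ℝ) + 1) ^ (p.1 + p.2 + 2) := by
  refine eq_of_hasSum_mul_pow_mul_pow (A := fun p => ∑' k, outerTerm k p)
    (B := fun p => ∑' m : ℕ, 1 / ((m : ℝ) + 1) ^ (p.1 + p.2 + 2))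
    (F := fun x y => ∑' k : ℕ, telescoper x y 0 k / (k + 1)) (ε := 1 / 4) (by norm_num)
    (fun x y hx hx' hy hy' => ?_) (fun x y hx hx' hy hy' => ?_) p
  · exact hasSum_tsum_mul_pow_mul_pow hx hy outerTerm_nonneg
      (hasSum_outerTerm hx (by linarith) y) (summable_telescoper hx hx' hy hy' 0).hasSum
  · exact hasSum_tsum_mul_pow_mul_pow (c := fun (m : ℕ) (p : ℕ × ℕ) =>
      1 / ((m : ℝ) + 1) ^ (p.1 + p.2 + 2)) hx hy (fun _ _ => by positivity)
      (hasSum_zeta_expansion hx (by linarith) hy (by linarith))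
      (hasSum_tsum_telescoper hx hx' hy hy')

end PowerSeriesExpansion

section Reindexing

/-- The summation indices of a multiple zeta value of depth `r`. -/
abbrev DecreasingTuple (r : ℕ) : Type :=
  {k : Fin r → ℕ // (∀ i j : Fin r, i < j → k j < k i) ∧ ∀ j, 0 < k j}

lemma DecreasingTuple.strictAnti_sub_one {r : ℕ} (k : DecreasingTuple r) :
    StrictAnti fun j => k.1 j - 1 := by
  intro i j hij
  have h1 := k.2.1 i j hij
  have h2 := k.2.2 j
  change k.1 j - 1 < k.1 i - 1
  omega

/-- The entries after the first one of a decreasing tuple, lowered by one. -/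
def DecreasingTuple.tailFinset {b : ℕ} (k : DecreasingTuple (b + 1)) : Finset ℕ :=
  univ.image fun j : Fin b => k.1 j.succ - 1

lemma DecreasingTuple.tailFinset_mem {b : ℕ} (k : DecreasingTuple (b + 1)) :
    k.tailFinset ∈ powersetCard b (range (k.1 0 - 1)) := by
  rw [mem_powersetCard]
  constructor
  · intro i hi
    obtain ⟨j, -, rfl⟩ := mem_image.1 hi
    exact mem_range.2 (k.strictAnti_sub_one j.succ_pos)
  · exact (card_image_of_injective _
      (k.strictAnti_sub_one.injective.comp (Fin.succ_injective b))).trans (card_fin b)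

lemma DecreasingTuple.insert_tailFinset {b : ℕ} (k : DecreasingTuple (b + 1)) :
    insert (k.1 0 - 1) k.tailFinset = univ.image fun j => k.1 j - 1 := by
  ext i
  simp [tailFinset, Fin.exists_fin_succ, eq_comm]

/-- Split a decreasing tuple into its first entry and the set of the others, all lowered
by one. -/
def DecreasingTuple.toSigma {b : ℕ} (k : DecreasingTuple (b + 1)) :
    Σ K : ℕ, powersetCard b (range K) :=
  ⟨k.1 0 - 1, k.tailFinset, k.tailFinset_mem⟩

lemma DecreasingTuple.toSigma_bijective (b : ℕ) :
    Function.Bijective (toSigma : DecreasingTuple (b + 1) → _) := by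
  constructor
  · intro k k' h
    have h1 : k.1 0 - 1 = k'.1 0 - 1 := congrArg Sigma.fst h
    have h2 : k.tailFinset = k'.tailFinset :=
      congrArg (fun q : Σ K : ℕ, powersetCard b (range K) => (q.2 : Finset ℕ)) h
    have h3 : Set.range (fun j => k.1 j - 1) = Set.range fun j => k'.1 j - 1 := by
      have h := k.insert_tailFinset
      rw [h1, h2, k'.insert_tailFinset] at h
      simpa using (congrArg (fun s : Finset ℕ => (s : Set ℕ)) h).symm
    have h4 := (k.strictAnti_sub_one.range_inj k'.strictAnti_sub_one).1 h3
    refine Subtype.ext (funext fun j => ?_)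
    have h5 : k.1 j - 1 = k'.1 j - 1 := congrFun h4 j
    have h6 := k.2.2 j
    have h7 := k'.2.2 j
    omega
  · rintro ⟨K, s, hs⟩
    obtain ⟨hsub, hcard⟩ := mem_powersetCard.1 hs
    let f : Fin b → ℕ := fun j => s.orderEmbOfFin hcard j.rev
    have hf : univ.image f = s := by
      rw [← coe_inj, coe_image, coe_univ, Set.image_univ, ← s.range_orderEmbOfFin hcard]
      exact Fin.rev_surjective.range_comp (s.orderEmbOfFin hcard)
    let k : DecreasingTuple (b + 1) := ⟨Fin.cons (K + 1) fun j => f j + 1, by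
      constructor
      · intro i j hij
        induction j using Fin.cases with
        | zero => exact absurd hij (Fin.not_lt_zero i)
        | succ j =>
          induction i using Fin.cases with
          | zero =>
            simp only [Fin.cons_zero, Fin.cons_succ, add_lt_add_iff_right]
            exact mem_range.1 (hsub (s.orderEmbOfFin_mem hcard _))
          | succ i =>
            simp only [Fin.cons_succ, add_lt_add_iff_right]
            exact (s.orderEmbOfFin hcard).strictMono
              (Fin.rev_lt_rev.2 (Fin.succ_lt_succ_iff.1 hij))
      · intro j
        induction j using Fin.cases <;> simp⟩
    refine ⟨k, ?_⟩
    have hk : k.tailFinset = s := by simpa [DecreasingTuple.tailFinset, k] using hf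
    have hk0 : k.1 0 - 1 = K := by simp [k]
    clear_value k
    subst hk0
    exact congrArg (Sigma.mk (k.1 0 - 1)) (Subtype.ext hk)

lemma hasSum_decreasingTuple (a b : ℕ) :
    HasSum (fun k : DecreasingTuple (b + 1) => 1 / (k.1 0 : ℝ) *
      PowerSeries.coeff a (∏ j, recipSeries (k.1 j - 1))) (∑' K, outerTerm K (a, b)) := by
  let f : (Σ K : ℕ, powersetCard b (range K)) → ℝ := fun q => 1 / ((q.1 : ℝ) + 1) *
    PowerSeries.coeff a (∏ j ∈ insert q.1 (q.2 : Finset ℕ), recipSeries j)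
  have hf : ∀ K, HasSum (fun s => f ⟨K, s⟩) (outerTerm K (a, b)) := by
    intro K
    have := hasSum_fintype fun s => f ⟨K, s⟩
    simp only [f] at this
    rwa [← mul_sum, sum_coe_sort (powersetCard b (range K)) fun s =>
      PowerSeries.coeff a (∏ j ∈ insert K s, recipSeries j)] at this
  have hs : Summable f := by
    rw [summable_sigma_of_nonneg fun q =>
      mul_nonneg (by positivity) (coeff_prod_recipSeries_nonneg _ _)]
    refine ⟨fun K => (hf K).summable, ?_⟩
    exact (summable_outerTerm (a, b)).congr fun K => (hf K).tsum_eq.symm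
  have h := HasSum.sigma_of_hasSum (summable_outerTerm (a, b)).hasSum hf hs
  rw [← (Equiv.ofBijective _ (DecreasingTuple.toSigma_bijective b)).hasSum_iff] at h
  refine h.of_eq (fun k => ?_) rfl
  have hk0 := k.2.2 0
  simp only [f, Function.comp_apply]
  change _ = 1 / (((k.1 0 - 1 : ℕ) : ℝ) + 1) *
    PowerSeries.coeff a (∏ j ∈ insert (k.1 0 - 1) k.tailFinset, recipSeries j)
  rw [k.insert_tailFinset, prod_image fun i _ j _ h => k.strictAnti_sub_one.injective h, Nat.cast_sub hk0]
  simp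

lemma tsum_composition (a r : ℕ) (F : (Fin r → ℕ) → ℝ) :
    ∑' n : {n : Fin r → ℕ // (∀ j, 0 < n j) ∧ ∑ j, n j = a + r}, F n.1 =
      ∑ l ∈ finsuppAntidiag (univ : Finset (Fin r)) a, F fun j => l j + 1 := by
  let e : finsuppAntidiag (univ : Finset (Fin r)) a ≃
      {n : Fin r → ℕ // (∀ j, 0 < n j) ∧ ∑ j, n j = a + r} :=
    { toFun := fun l => ⟨fun j => l.1 j + 1, fun j => Nat.succ_pos _, by
        have := (mem_finsuppAntidiag.1 l.2).1
        simp [sum_add_distrib, this]⟩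
      invFun := fun n => ⟨Finsupp.equivFunOnFinite.symm fun j => n.1 j - 1, by
        rw [mem_finsuppAntidiag]
        refine ⟨?_, subset_univ _⟩
        have h : ∑ j, (n.1 j - 1 + 1) = a + r :=
          (sum_congr rfl fun j _ => Nat.sub_add_cancel (n.2.1 j)).trans n.2.2
        simpa [sum_add_distrib] using h⟩
      left_inv := fun l => by ext; simp
      right_inv := fun n => Subtype.ext (funext fun j => Nat.sub_add_cancel (n.2.1 j)) }
  rw [← e.tsum_eq, tsum_fintype]
  exact sum_coe_sort (finsuppAntidiag (univ : Finset (Fin r)) a) fun l => F fun j => l j + 1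

lemma prod_shifted_eq {b : ℕ} (k : DecreasingTuple (b + 1)) (l : Fin (b + 1) → ℕ) :
    ∏ j, (1 : ℝ) / (k.1 j : ℝ) ^ (if j.val = 0 then l j + 1 + 1 else l j + 1) =
      1 / (k.1 0 : ℝ) * ∏ j, PowerSeries.coeff (l j) (recipSeries (k.1 j - 1)) := by
  have h : ∀ j, PowerSeries.coeff (l j) (recipSeries (k.1 j - 1)) =
      1 / (k.1 j : ℝ) ^ (l j + 1) := by
    intro j
    rw [recipSeries, PowerSeries.coeff_mk, Nat.cast_sub (k.2.2 j)]
    simp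
  simp only [h, Fin.prod_univ_succ, Fin.val_zero, if_true, Fin.val_succ, Nat.succ_ne_zero,
    if_false]
  rw [← mul_assoc, pow_succ _ (l 0 + 1), one_div_mul_one_div, mul_comm (k.1 0 : ℝ)]

lemma mzv_depth_one (n : ℕ) : mzv (fun _ : Fin 1 => n) = ∑' m : ℕ, 1 / ((m : ℝ) + 1) ^ n := by
  let e : ℕ ≃ DecreasingTuple 1 :=
    { toFun := fun m => ⟨fun _ => m + 1,
        fun i j hij => absurd hij (by simp [Subsingleton.elim i j]), fun _ => Nat.succ_pos m⟩
      invFun := fun k => k.1 0 - 1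
      left_inv := fun m => rfl
      right_inv := fun k => Subtype.ext (funext fun j => by
        rw [Subsingleton.elim j 0]
        exact Nat.sub_add_cancel (k.2.2 0)) }
  rw [mzv, ← e.tsum_eq]
  simp [e]

end Reindexing

/-- The sum formula: the sum of shifted multiple zeta values
`ζ*(n₁,…,n_r) = ζ(1+n₁,n₂,…,n_r)` over all compositions of `N` into `r`
positive parts equals `ζ*(N) = ζ(1+N)`. -/
theorem sum_formula (N r : ℕ) (hr : 0 < r) (hN : r ≤ N) :
    (∑' n : {n : Fin r → ℕ // (∀ j, 0 < n j) ∧ (∑ j, n j) = N},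
      mzv (fun j => if j.val = 0 then n.1 j + 1 else n.1 j))
    = mzv (fun _ : Fin 1 => N + 1) := by
  obtain ⟨a, rfl⟩ := Nat.exists_eq_add_of_le' hN
  obtain ⟨b, rfl⟩ := Nat.exists_eq_add_of_lt hr
  rw [zero_add] at *
  rw [tsum_composition a (b + 1) fun n => mzv fun j => if j.val = 0 then n j + 1 else n j]
  have hsum := hasSum_decreasingTuple a b
  have hnn : ∀ (k : DecreasingTuple (b + 1)) (l : Fin (b + 1) →₀ ℕ),
      0 ≤ 1 / (k.1 0 : ℝ) * ∏ j, PowerSeries.coeff (l j) (recipSeries (k.1 j - 1)) := by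
    intro k l
    rw [← prod_shifted_eq]
    positivity
  simp only [PowerSeries.coeff_prod, mul_sum] at hsum
  simp only [mzv, prod_shifted_eq]
  rw [← Summable.tsum_finsetSum fun l hl => Summable.of_nonneg_of_le (fun k => hnn k l)
    (fun k => single_le_sum (fun l _ => hnn k l) hl) hsum.summable, hsum.tsum_eq, tsum_outerTerm]
  exact (mzv_depth_one (a + (b + 1) + 1)).symm
end

section
/- Let 0<q<1, let r be a positive integer, and let z be a complex number not belonging to the set {q^{-m}[m]_q : m a positive integer}. Then Σ_{k_1>...>k_r>0} (q^{k_1}/[k_1]_q) ∏_{j=1}^r 1/([k_j]_q − z q^{k_j}) = Σ_{m=1}^∞ q^{rm}/([m]_q^r ([m]_q − z q^m)), where the left-hand sum is over all r-tuples of positive integers k_1 > k_2 > ... > k_r > 0 and both series converge absolutely. -/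
open Filter Topology Finset

namespace QSum

/-- Strictly decreasing `r`-tuples of positive integers. -/
abbrev DecTuple (r : ℕ) : Type :=
  {k : Fin r → ℕ // (∀ i j : Fin r, i < j → k j < k i) ∧ ∀ j, 0 < k j}

/-- The largest entry of a decreasing tuple, `0` for the empty tuple. -/
def DecTuple.top {r : ℕ} (t : DecTuple r) : ℕ := univ.sup t.1

lemma DecTuple.le_top {r : ℕ} (t : DecTuple r) (j : Fin r) : t.1 j ≤ t.top :=
  le_sup (f := t.1) (mem_univ j)

lemma DecTuple.top_eq {r : ℕ} (hr : 0 < r) (t : DecTuple r) : t.top = t.1 ⟨0, hr⟩ := by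
  refine le_antisymm (Finset.sup_le fun j _ => ?_) (t.le_top _)
  rcases eq_or_ne j ⟨0, hr⟩ with rfl | h
  · exact le_rfl
  · refine (t.2.1 _ _ (lt_of_le_of_ne ?_ h.symm)).le
    exact Fin.mk_le_of_le_val (Nat.zero_le _)

/-- A decreasing tuple of length `r + 1` is a decreasing tuple of length `r` together with the
gap between its largest entry and a new, larger one. -/
def consEquiv (r : ℕ) : DecTuple r × ℕ ≃ DecTuple (r + 1) where
  toFun p := ⟨Fin.cons (p.1.top + 1 + p.2) p.1.1, by
    constructor
    · intro i j hij
      induction j using Fin.cases with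
      | zero => exact absurd hij (Fin.not_lt_zero i)
      | succ j =>
        induction i using Fin.cases with
        | zero =>
          have := p.1.le_top j
          simp only [Fin.cons_zero, Fin.cons_succ]
          omega
        | succ i =>
          simp only [Fin.cons_succ]
          exact p.1.2.1 i j (Fin.succ_lt_succ_iff.1 hij)
    · intro j
      induction j using Fin.cases with
      | zero => simp only [Fin.cons_zero]; omega
      | succ j => exact p.1.2.2 j⟩
  invFun k := (⟨fun j => k.1 j.succ, fun i j h => k.2.1 _ _ (Fin.succ_lt_succ_iff.2 h),
    fun j => k.2.2 _⟩, k.1 0 - (univ.sup (fun j : Fin r => k.1 j.succ) + 1))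
  left_inv p := by
    refine Prod.ext (Subtype.ext (funext fun j => by simp)) ?_
    simp only [Fin.cons_zero, Fin.cons_succ]
    change p.1.top + 1 + p.2 - (p.1.top + 1) = p.2
    omega
  right_inv k := by
    have h : univ.sup (fun j : Fin r => k.1 j.succ) < k.1 0 :=
      (Finset.sup_lt_iff (k.2.2 0)).2 fun j _ => k.2.1 _ _ (Fin.succ_pos j)
    refine Subtype.ext (funext fun j => ?_)
    induction j using Fin.cases with
    | zero =>
      change univ.sup (fun j : Fin r => k.1 j.succ) + 1 +
        (k.1 0 - (univ.sup (fun j : Fin r => k.1 j.succ) + 1)) = k.1 0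
      omega
    | succ j => simp

lemma top_consEquiv {r : ℕ} (p : DecTuple r × ℕ) : (consEquiv r p).top = p.1.top + 1 + p.2 := by
  rw [DecTuple.top_eq r.succ_pos]
  rfl

lemma prod_consEquiv {r : ℕ} (p : DecTuple r × ℕ) (f : ℕ → ℂ) :
    ∏ j, f ((consEquiv r p).1 j) = f (p.1.top + 1 + p.2) * ∏ j, f (p.1.1 j) := by
  rw [Fin.prod_univ_succ]
  rfl

lemma summable_pow_top {x : ℝ} (hx0 : 0 ≤ x) (hx1 : x < 1) (r : ℕ) :
    Summable fun t : DecTuple r => x ^ t.top := by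
  induction r with
  | zero => exact Summable.of_finite
  | succ r ih =>
    rw [← (consEquiv r).summable_iff]
    refine ((ih.mul_of_nonneg (summable_geometric_of_lt_one hx0 hx1)
      (fun _ => by positivity) (fun _ => by positivity)).mul_left x).congr fun p => ?_
    simp only [Function.comp_apply, top_consEquiv]
    ring

/-- The finite product `(qw; q)_n`. -/
noncomputable def poch (q w : ℂ) (n : ℕ) : ℂ := ∏ j ∈ range n, (1 - q ^ (j + 1) * w)

/-- The connector of the connected sum. -/
noncomputable def conn (q w : ℂ) (n m : ℕ) : ℂ :=
  q ^ (n * m) * (poch q w n * poch q w m * (poch q w (n + m))⁻¹)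

lemma conn_comm (q w : ℂ) (n m : ℕ) : conn q w n m = conn q w m n := by
  simp only [conn, mul_comm n m, add_comm n m, mul_comm (poch q w n)]

section

variable {q w : ℂ}

lemma poch_ne_zero (hw : ∀ k : ℕ, 0 < k → 1 - q ^ k * w ≠ 0) (n : ℕ) : poch q w n ≠ 0 :=
  prod_ne_zero_iff.2 fun j _ => hw (j + 1) j.succ_pos

lemma conn_zero_right (hw : ∀ k : ℕ, 0 < k → 1 - q ^ k * w ≠ 0) (n : ℕ) : conn q w n 0 = 1 := by
  have := poch_ne_zero hw n
  simp [conn, poch] at this ⊢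
  exact mul_inv_cancel₀ this

lemma one_sub_pow_ne_zero (hq : ‖q‖ < 1) {n : ℕ} (hn : 0 < n) : 1 - q ^ n ≠ 0 := by
  intro h
  have h1 : ‖q ^ n‖ < 1 := by
    rw [norm_pow]
    exact pow_lt_one₀ (norm_nonneg q) hq hn.ne'
  rw [← sub_eq_zero.1 h, norm_one] at h1
  exact lt_irrefl _ h1

lemma conn_succ_mul_inv (hq : ‖q‖ < 1) (hw : ∀ k : ℕ, 0 < k → 1 - q ^ k * w ≠ 0)
    {n : ℕ} (hn : 0 < n) (m : ℕ) :
    conn q w n (m + 1) * (1 - q ^ (m + 1) * w)⁻¹ =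
      q ^ n / (1 - q ^ n) * (conn q w n m - conn q w n (m + 1)) := by
  have h1 := one_sub_pow_ne_zero hq hn
  have h2 := hw (m + 1) m.succ_pos
  have h3 := hw (n + m + 1) (Nat.succ_pos _)
  have h4 := poch_ne_zero hw (n + m)
  have e1 : poch q w (m + 1) = poch q w m * (1 - q ^ (m + 1) * w) := prod_range_succ _ _
  have e2 : poch q w (n + (m + 1)) = poch q w (n + m) * (1 - q ^ (n + m + 1) * w) :=
    prod_range_succ _ _
  simp only [conn, e1, e2]
  generalize hA : 1 - q ^ (n + m + 1) * w = A at h3 ⊢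
  field_simp
  rw [← hA]
  ring

lemma tendsto_one_sub_pow_mul (hq : ‖q‖ < 1) (w : ℂ) :
    Tendsto (fun k : ℕ => 1 - q ^ k * w) atTop (𝓝 1) := by
  simpa using ((tendsto_pow_atTop_nhds_zero_of_norm_lt_one hq).mul_const w).const_sub 1

lemma exists_norm_le_of_tendsto {u : ℕ → ℂ} {a : ℂ} (h : Tendsto u atTop (𝓝 a)) :
    ∃ K, 0 ≤ K ∧ ∀ n, ‖u n‖ ≤ K := by
  obtain ⟨K, hK⟩ := h.norm.bddAbove_range
  have hK' : ∀ n, ‖u n‖ ≤ K := fun n => hK ⟨n, rfl⟩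
  exact ⟨K, (norm_nonneg _).trans (hK' 0), hK'⟩

lemma exists_norm_inv_le (hq : ‖q‖ < 1) (w : ℂ) :
    ∃ B, 0 ≤ B ∧ ∀ k : ℕ, ‖(1 - q ^ k * w)⁻¹‖ ≤ B :=
  exists_norm_le_of_tendsto ((tendsto_one_sub_pow_mul hq w).inv₀ one_ne_zero)

lemma exists_norm_conn_le (hq : ‖q‖ < 1) (hw : ∀ k : ℕ, 0 < k → 1 - q ^ k * w ≠ 0) :
    ∃ K, 0 ≤ K ∧ ∀ n m, ‖conn q w n m‖ ≤ K * ‖q‖ ^ (n * m) := by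
  have hs : Summable fun j : ℕ => ‖-(q ^ (j + 1) * w)‖ := by
    simp only [norm_neg, norm_mul, norm_pow]
    exact ((summable_nat_add_iff 1).2
      (summable_geometric_of_lt_one (norm_nonneg q) hq)).mul_right _
  have hL : Tendsto (poch q w) atTop (𝓝 (∏' j : ℕ, (1 + -(q ^ (j + 1) * w)))) := by
    refine (multipliable_one_add_of_summable hs).tendsto_prod_tprod_nat.congr fun n => ?_
    simp only [poch, sub_eq_add_neg]
  have hL0 : ∏' j : ℕ, (1 + -(q ^ (j + 1) * w)) ≠ 0 := by
    refine tprod_one_add_ne_zero_of_summable (fun j => ?_) hs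
    rw [← sub_eq_add_neg]
    exact hw (j + 1) j.succ_pos
  obtain ⟨K₁, h₁0, h₁⟩ := exists_norm_le_of_tendsto hL
  obtain ⟨K₂, h₂0, h₂⟩ := exists_norm_le_of_tendsto (hL.inv₀ hL0)
  refine ⟨K₁ * K₁ * K₂, by positivity, fun n m => ?_⟩
  rw [conn, norm_mul, norm_mul, norm_mul, norm_pow, mul_comm]
  gcongr
  exacts [h₁ n, h₁ m, h₂ (n + m)]

lemma tendsto_conn (hq : ‖q‖ < 1) (hw : ∀ k : ℕ, 0 < k → 1 - q ^ k * w ≠ 0) {n : ℕ} (hn : 0 < n) :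
    Tendsto (conn q w n) atTop (𝓝 0) := by
  obtain ⟨K, hK0, hK⟩ := exists_norm_conn_le hq hw
  refine squeeze_zero_norm (a := fun m => K * ‖q‖ ^ m) (fun m => (hK n m).trans ?_) ?_
  · gcongr K * ?_
    exact pow_le_pow_of_le_one (norm_nonneg q) hq.le (Nat.le_mul_of_pos_left m hn)
  · simpa using (tendsto_pow_atTop_nhds_zero_of_lt_one (norm_nonneg q) hq).const_mul K

lemma hasSum_conn (hq : ‖q‖ < 1) (hw : ∀ k : ℕ, 0 < k → 1 - q ^ k * w ≠ 0) {n : ℕ} (hn : 0 < n)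
    (m : ℕ) :
    HasSum (fun d => conn q w n (m + 1 + d) * (1 - q ^ (m + 1 + d) * w)⁻¹)
      (q ^ n / (1 - q ^ n) * conn q w n m) := by
  have hs : Summable fun d => conn q w n (m + 1 + d) * (1 - q ^ (m + 1 + d) * w)⁻¹ := by
    obtain ⟨K, hK0, hK⟩ := exists_norm_conn_le hq hw
    obtain ⟨B, hB0, hB⟩ := exists_norm_inv_le hq w
    refine Summable.of_norm_bounded (g := fun d => K * ‖q‖ ^ d * B)
      (((summable_geometric_of_lt_one (norm_nonneg q) hq).mul_left K).mul_right B) fun d => ?_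
    rw [norm_mul]
    gcongr
    · refine (hK _ _).trans ?_
      gcongr K * ?_
      refine pow_le_pow_of_le_one (norm_nonneg q) hq.le ?_
      nlinarith
    · exact hB _
  rw [hs.hasSum_iff_tendsto_nat]
  have ht : Tendsto (fun D => conn q w n (m + D)) atTop (𝓝 0) :=
    (tendsto_conn hq hw hn).comp (tendsto_add_atTop_nat m |>.congr fun D => add_comm D m)
  have := (ht.const_sub (conn q w n m)).const_mul (q ^ n / (1 - q ^ n))
  rw [sub_zero] at this
  refine this.congr fun D => ?_
  have := sum_range_sub' (fun D => conn q w n (m + D)) D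
  rw [add_zero] at this
  rw [← this, mul_sum]
  refine sum_congr rfl fun d _ => ?_
  rw [add_right_comm, conn_succ_mul_inv hq hw hn, add_assoc m d 1]

lemma summable_connected (hq : ‖q‖ < 1) (hw : ∀ k : ℕ, 0 < k → 1 - q ^ k * w ≠ 0) {r : ℕ}
    (hr : 0 < r) :
    Summable fun p : DecTuple r × ℕ =>
      conn q w p.1.top (p.2 + 1) * (1 - q ^ (p.2 + 1) * w)⁻¹ *
        ∏ j, (1 - q ^ (p.1.1 j) * w)⁻¹ := by
  obtain ⟨K, hK0, hK⟩ := exists_norm_conn_le hq hw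
  obtain ⟨B, hB0, hB⟩ := exists_norm_inv_le hq w
  refine Summable.of_norm_bounded
    (g := fun p : DecTuple r × ℕ => K * (‖q‖ ^ p.1.top * ‖q‖ ^ p.2) * B * B ^ r)
    (((((summable_pow_top (norm_nonneg q) hq r).mul_of_nonneg
      (summable_geometric_of_lt_one (norm_nonneg q) hq)
      (fun _ => by positivity) (fun _ => by positivity)).mul_left K).mul_right B).mul_right _)
    fun p => ?_
  rw [norm_mul, norm_mul, norm_prod]
  gcongr
  · refine (hK _ _).trans ?_
    rw [← pow_add]
    gcongr K * ?_
    refine pow_le_pow_of_le_one (norm_nonneg q) hq.le ?_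
    have : 0 < p.1.top := by
      rw [DecTuple.top_eq hr]
      exact p.1.2.2 _
    nlinarith
  · exact hB _
  · refine (prod_le_prod (fun _ _ => norm_nonneg _) fun j _ => hB (p.1.1 j)).trans ?_
    simp

lemma summable_conn_top (hq : ‖q‖ < 1) (hw : ∀ k : ℕ, 0 < k → 1 - q ^ k * w ≠ 0) {r : ℕ}
    (hr : 0 < r) (m : ℕ) :
    Summable fun t : DecTuple r => conn q w t.top (m + 1) * ∏ j, (1 - q ^ (t.1 j) * w)⁻¹ := by
  refine (((summable_connected hq hw hr).prod_symm.prod_factor m).mul_left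
    (1 - q ^ (m + 1) * w)).congr fun t => ?_
  have := hw (m + 1) m.succ_pos
  simp only [Prod.swap_prod_mk]
  field_simp

lemma hasSum_conn_top (hq : ‖q‖ < 1) (hw : ∀ k : ℕ, 0 < k → 1 - q ^ k * w ≠ 0) (r m : ℕ) :
    HasSum (fun t : DecTuple r => conn q w t.top (m + 1) * ∏ j, (1 - q ^ (t.1 j) * w)⁻¹)
      ((q ^ (m + 1) / (1 - q ^ (m + 1))) ^ r) := by
  induction r with
  | zero =>
    let _ : Unique (DecTuple 0) :=
      ⟨⟨⟨Fin.elim0, fun i => i.elim0, fun i => i.elim0⟩⟩, fun t => Subtype.ext (Subsingleton.elim _ _)⟩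
    convert hasSum_unique (β := DecTuple 0) _
    simp [DecTuple.top, conn_comm q w 0, conn_zero_right hw]
  | succ r ih =>
    have hs := summable_conn_top hq hw r.succ_pos m
    rw [← (consEquiv r).summable_iff] at hs
    rw [← (consEquiv r).hasSum_iff]
    have hf := hs.hasSum.prod_fiberwise
      (g := fun t : DecTuple r => q ^ (m + 1) / (1 - q ^ (m + 1)) *
        (conn q w t.top (m + 1) * ∏ j, (1 - q ^ (t.1 j) * w)⁻¹)) fun t => by
      rw [← mul_assoc, conn_comm q w t.top]
      refine ((hasSum_conn hq hw m.succ_pos t.top).mul_right _).congr_fun fun d => ?_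
      simp only [Function.comp_apply, top_consEquiv,
        prod_consEquiv (t, d) fun k => (1 - q ^ k * w)⁻¹, conn_comm q w _ (m + 1), mul_assoc]
    rw [pow_succ', ← hf.unique (ih.mul_left _)]
    exact hs.hasSum

lemma hasSum_connected (hq : ‖q‖ < 1) (hw : ∀ k : ℕ, 0 < k → 1 - q ^ k * w ≠ 0) {r : ℕ}
    (hr : 0 < r) :
    ∃ S : ℂ,
      HasSum (fun t : DecTuple r =>
        q ^ t.top / (1 - q ^ t.top) * ∏ j, (1 - q ^ (t.1 j) * w)⁻¹) S ∧
      HasSum (fun m : ℕ =>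
        (q ^ (m + 1) / (1 - q ^ (m + 1))) ^ r * (1 - q ^ (m + 1) * w)⁻¹) S := by
  have hs := (summable_connected hq hw hr).hasSum
  refine ⟨_, hs.prod_fiberwise fun t => ?_,
    ((Equiv.prodComm _ _).hasSum_iff.2 hs).prod_fiberwise fun m => ?_⟩
  · have ht : 0 < t.top := by
      rw [DecTuple.top_eq hr]
      exact t.2.2 _
    have := hasSum_conn hq hw ht 0
    rw [conn_zero_right hw, mul_one] at this
    refine (this.mul_right _).congr_fun fun d => ?_
    rw [zero_add, add_comm 1 d]
  · refine ((hasSum_conn_top hq hw r m).mul_right _).congr_fun fun t => ?_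
    exact mul_right_comm _ _ _

end

end QSum

/-- Generating-function form of the q-sum formula. -/
theorem q_sum_gf (q : ℝ) (hq0 : 0 < q) (hq1 : q < 1) (r : ℕ) (hr : 0 < r)
    (z : ℂ) (hz : ∀ m : ℕ, 0 < m → z ≠ (q : ℂ) ^ (-(m : ℤ)) * (qnum q m : ℂ)) :
    Summable (fun k : {k : Fin r → ℕ // (∀ i j : Fin r, i < j → k j < k i) ∧ ∀ j, 0 < k j} =>
        ((q : ℂ) ^ (k.1 ⟨0, hr⟩) / (qnum q (k.1 ⟨0, hr⟩) : ℂ)) *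
          ∏ j : Fin r, 1 / ((qnum q (k.1 j) : ℂ) - z * (q : ℂ) ^ (k.1 j))) ∧
    Summable (fun m : ℕ => (q : ℂ) ^ (r * (m + 1)) /
        ((qnum q (m + 1) : ℂ) ^ r * ((qnum q (m + 1) : ℂ) - z * (q : ℂ) ^ (m + 1)))) ∧
    (∑' k : {k : Fin r → ℕ // (∀ i j : Fin r, i < j → k j < k i) ∧ ∀ j, 0 < k j},
        ((q : ℂ) ^ (k.1 ⟨0, hr⟩) / (qnum q (k.1 ⟨0, hr⟩) : ℂ)) *
          ∏ j : Fin r, 1 / ((qnum q (k.1 j) : ℂ) - z * (q : ℂ) ^ (k.1 j)))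
      = ∑' m : ℕ, (q : ℂ) ^ (r * (m + 1)) /
          ((qnum q (m + 1) : ℂ) ^ r * ((qnum q (m + 1) : ℂ) - z * (q : ℂ) ^ (m + 1))) := by
  have hc : (1 - q : ℂ) ≠ 0 := by
    exact_mod_cast (sub_pos.2 hq1).ne'
  have hq0' : (q : ℂ) ≠ 0 := by exact_mod_cast hq0.ne'
  have hq : ‖(q : ℂ)‖ < 1 := by
    rwa [Complex.norm_real, Real.norm_of_nonneg hq0.le]
  have hnum (k : ℕ) : (qnum q k : ℂ) = (1 - (q : ℂ) ^ k) / (1 - q) := by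
    simp [qnum]
  have hden (k : ℕ) : (qnum q k : ℂ) - z * (q : ℂ) ^ k =
      (1 - (q : ℂ) ^ k * (1 + (1 - q) * z)) / (1 - q) := by
    rw [hnum]
    field_simp
    ring
  have hw (k : ℕ) (hk : 0 < k) : 1 - (q : ℂ) ^ k * (1 + (1 - q) * z) ≠ 0 := by
    intro h
    refine hz k hk ?_
    have h' := hden k
    rw [h, zero_div, sub_eq_zero] at h'
    rw [h', zpow_neg, zpow_natCast]
    field_simp
  obtain ⟨S, hL, hR⟩ := QSum.hasSum_connected hq hw hr
  have hL' := (hL.mul_left ((1 - q : ℂ) ^ (r + 1))).congr_fun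
    (g := fun k : QSum.DecTuple r =>
      ((q : ℂ) ^ (k.1 ⟨0, hr⟩) / (qnum q (k.1 ⟨0, hr⟩) : ℂ)) *
        ∏ j : Fin r, 1 / ((qnum q (k.1 j) : ℂ) - z * (q : ℂ) ^ (k.1 j))) fun k => by
    simp only [one_div, hden, inv_div, div_eq_mul_inv (1 - q : ℂ), prod_mul_distrib, prod_const,
      card_univ, Fintype.card_fin]
    rw [hnum, QSum.DecTuple.top_eq hr]
    simp only [div_eq_mul_inv, mul_inv, inv_inv]
    ring
  have hR' := (hR.mul_left ((1 - q : ℂ) ^ (r + 1))).congr_fun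
    (g := fun m : ℕ => (q : ℂ) ^ (r * (m + 1)) /
      ((qnum q (m + 1) : ℂ) ^ r * ((qnum q (m + 1) : ℂ) - z * (q : ℂ) ^ (m + 1)))) fun m => by
    rw [hden, hnum, mul_comm r, pow_mul, div_pow, div_pow]
    simp only [div_eq_mul_inv, mul_inv, inv_inv]
    ring
  exact ⟨hL'.summable, hR'.summable, hL'.tsum_eq.trans hR'.tsum_eq.symm⟩
end

section
/- Let m ≥ 2 be an integer. Then 2ζ(m,1) = m ζ(m+1) − Σ_{k=1}^{m-2} ζ(m−k) ζ(k+1), where ζ(n) denotes the Riemann zeta value Σ_{k=1}^∞ k^{-n}. -/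
/-- The Riemann zeta value `ζ(n) = Σ_{k≥1} 1/k^n`. -/
noncomputable def rzeta (n : ℕ) : ℝ := ∑' k : ℕ, 1 / ((k : ℝ) + 1) ^ n

/-- The double zeta value `ζ(m,1) = Σ_{k₁>k₂>0} 1/(k₁^m k₂)`. -/
noncomputable def zeta_m_one (m : ℕ) : ℝ :=
  ∑' p : {p : ℕ × ℕ // p.2 < p.1 ∧ 0 < p.2}, 1 / ((p.1.1 : ℝ) ^ m * (p.1.2 : ℝ))

theorem hasSum_congr {ι : Type*} {f g : ι → ℝ} {s : ℝ} (h : ∀ i, f i = g i) :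
    HasSum f s ↔ HasSum g s := by
  rw [funext h]

theorem summable_one_div_mul_mul_add :
    Summable fun p : ℕ × ℕ => 1 / (((p.1 : ℝ) + 1) * (p.2 + 1) * (p.1 + p.2 + 2)) := by
  have h : Summable fun k : ℕ => 1 / ((k : ℝ) + 1) ^ (3 / 2 : ℝ) := by
    have := (summable_nat_add_iff 1).2
      (Real.summable_one_div_nat_rpow.2 (by norm_num : (1 : ℝ) < 3 / 2))
    simpa using this
  have h2 := h.mul_of_nonneg h (fun k => by positivity) (fun k => by positivity)
  refine Summable.of_nonneg_of_le (fun p => by positivity) (fun p => ?_) h2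
  have hA : (0 : ℝ) < (p.1 : ℝ) + 1 := by positivity
  have hD : (0 : ℝ) < (p.2 : ℝ) + 1 := by positivity
  rw [div_mul_div_comm, one_mul, ← Real.mul_rpow hA.le hD.le]
  refine one_div_le_one_div_of_le (by positivity) ?_
  have e : (((p.1 : ℝ) + 1) * (p.2 + 1)) ^ (3 / 2 : ℝ)
      = (((p.1 : ℝ) + 1) * (p.2 + 1)) * √(((p.1 : ℝ) + 1) * (p.2 + 1)) := by
    rw [Real.sqrt_eq_rpow, ← Real.rpow_one_add' (by positivity) (by norm_num)]
    norm_num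
  rw [e]
  gcongr
  refine Real.sqrt_le_iff.2 ⟨by positivity, ?_⟩
  nlinarith

theorem summable_one_div_add_pow_mul (n : ℕ) :
    Summable fun p : ℕ × ℕ => 1 / (((p.1 : ℝ) + p.2 + 2) ^ (n + 2) * (p.2 + 1)) := by
  refine Summable.of_nonneg_of_le (fun p => by positivity) (fun p => ?_)
    summable_one_div_mul_mul_add
  refine one_div_le_one_div_of_le (by positivity) ?_
  have h1 : (1 : ℝ) ≤ ((p.1 : ℝ) + p.2 + 2) ^ n :=
    one_le_pow₀ (by have : (0 : ℝ) ≤ (p.1 : ℝ) + p.2 := by positivity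
                    linarith)
  calc ((p.1 : ℝ) + 1) * (p.2 + 1) * (p.1 + p.2 + 2)
      ≤ ((p.1 : ℝ) + p.2 + 2) * (p.2 + 1) * (p.1 + p.2 + 2) := by
        gcongr ?_ * _ * _
        have : (0 : ℝ) ≤ p.2 := by positivity
        linarith
    _ = 1 * (((p.1 : ℝ) + p.2 + 2) ^ 2 * (p.2 + 1)) := by ring
    _ ≤ ((p.1 : ℝ) + p.2 + 2) ^ n * (((p.1 : ℝ) + p.2 + 2) ^ 2 * (p.2 + 1)) := by gcongr
    _ = _ := by ring

theorem summable_one_div_pow_mul_mul_add (n : ℕ) :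
    Summable fun p : ℕ × ℕ => 1 / (((p.1 : ℝ) + 1) ^ (n + 1) * (p.2 + 1) * (p.1 + p.2 + 2)) := by
  refine Summable.of_nonneg_of_le (fun p => by positivity) (fun p => ?_)
    summable_one_div_mul_mul_add
  refine one_div_le_one_div_of_le (by positivity) ?_
  gcongr
  exact le_self_pow₀ (by simp) (by simp)

/-- The pairs `0 < k₂ < k₁`, parametrised by `k₁ - k₂ - 1` and `k₂ - 1`. -/
def pairEquiv : ℕ × ℕ ≃ {p : ℕ × ℕ // p.2 < p.1 ∧ 0 < p.2} where
  toFun q := ⟨(q.1 + q.2 + 2, q.2 + 1), by dsimp; omega⟩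
  invFun p := (p.1.1 - p.1.2 - 1, p.1.2 - 1)
  left_inv q := by ext <;> simp; omega
  right_inv p := by
    obtain ⟨⟨a, b⟩, h⟩ := p
    dsimp at h
    ext <;> dsimp <;> omega

theorem zeta_m_one_eq_tsum_prod (m : ℕ) :
    zeta_m_one m = ∑' p : ℕ × ℕ, 1 / (((p.1 : ℝ) + p.2 + 2) ^ m * (p.2 + 1)) := by
  rw [zeta_m_one, ← pairEquiv.tsum_eq]
  simp [pairEquiv]

theorem hasSum_zeta_m_one_harmonic (n : ℕ) :
    HasSum (fun k : ℕ => (∑ i ∈ Finset.range k, 1 / ((i : ℝ) + 1)) / ((k : ℝ) + 1) ^ (n + 2))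
      (zeta_m_one (n + 2)) := by
  have h := (summable_one_div_add_pow_mul n).hasSum
  rw [← zeta_m_one_eq_tsum_prod,
    ← Finset.HasAntidiagonal.sigmaAntidiagonalEquivProd.hasSum_iff] at h
  have h2 := h.sigma fun k => hasSum_fintype _
  rw [← hasSum_nat_add_iff' 1]
  simp only [Finset.range_one, Finset.sum_singleton, Finset.range_zero, Finset.sum_empty,
    zero_div, sub_zero]
  refine (hasSum_congr fun k => ?_).2 h2
  dsimp [Finset.HasAntidiagonal.sigmaAntidiagonalEquivProd]
  rw [Finset.sum_attach (Finset.HasAntidiagonal.antidiagonal k)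
    (fun p : ℕ × ℕ => 1 / (((p.1 : ℝ) + p.2 + 2) ^ (n + 2) * (p.2 + 1))),
    Finset.sum_congr rfl (g := fun p : ℕ × ℕ => 1 / (((k : ℝ) + 2) ^ (n + 2) * (p.2 + 1))),
    ← Finset.Nat.sum_antidiagonal_swap,
    Finset.Nat.sum_antidiagonal_eq_sum_range_succ_mk, Finset.sum_div]
  · refine Finset.sum_congr rfl fun i _ => ?_
    dsimp
    push_cast
    field_simp
    ring
  · intro p hp
    rw [← Finset.HasAntidiagonal.mem_antidiagonal.1 hp]
    push_cast
    rfl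

theorem hasSum_one_div_sub_one_div_add_one (a : ℕ) :
    HasSum (fun d : ℕ => 1 / ((d : ℝ) + a + 1) - 1 / ((d : ℝ) + a + 2)) (1 / ((a : ℝ) + 1)) := by
  rw [hasSum_iff_tendsto_nat_of_nonneg]
  · have h : ∀ N : ℕ, ∑ d ∈ Finset.range N, (1 / ((d : ℝ) + a + 1) - 1 / ((d : ℝ) + a + 2))
        = 1 / ((a : ℝ) + 1) - 1 / (((N + a : ℕ) : ℝ) + 1) := by
      intro N
      have := Finset.sum_range_sub' (fun d : ℕ => 1 / ((d : ℝ) + a + 1)) N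
      push_cast at this ⊢
      rw [zero_add] at this
      rw [← this]
      refine Finset.sum_congr rfl fun d _ => ?_
      ring
    simp_rw [h]
    simpa using (tendsto_const_nhds (x := 1 / ((a : ℝ) + 1))).sub
      ((Filter.tendsto_add_atTop_iff_nat a).2 (tendsto_one_div_add_atTop_nhds_zero_nat (𝕜 := ℝ)))
  · intro d
    rw [sub_nonneg]
    exact one_div_le_one_div_of_le (by positivity) (by linarith)

theorem hasSum_one_div_sub_one_div_add (a : ℕ) :
    HasSum (fun d : ℕ => 1 / ((d : ℝ) + 1) - 1 / ((d : ℝ) + a + 1))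
      (∑ i ∈ Finset.range a, 1 / ((i : ℝ) + 1)) := by
  induction a with
  | zero => simp
  | succ a ih =>
    rw [Finset.sum_range_succ]
    convert ih.add (hasSum_one_div_sub_one_div_add_one a) using 2 with d
    push_cast
    ring

theorem summable_one_div_add_one_pow (n : ℕ) :
    Summable fun k : ℕ => 1 / ((k : ℝ) + 1) ^ (n + 2) := by
  simpa using (summable_nat_add_iff 1).2
    (Real.summable_one_div_nat_pow.2 (by omega : 1 < n + 2))

theorem tsum_one_div_pow_mul_mul_add (n : ℕ) :
    ∑' p : ℕ × ℕ, 1 / (((p.1 : ℝ) + 1) ^ (n + 1) * (p.2 + 1) * (p.1 + p.2 + 2))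
      = zeta_m_one (n + 2) + rzeta (n + 3) := by
  have h := (summable_one_div_pow_mul_mul_add n).hasSum.prod_fiberwise
    (g := fun a => (∑ i ∈ Finset.range (a + 1), 1 / ((i : ℝ) + 1)) / ((a : ℝ) + 1) ^ (n + 2)) ?_
  · refine h.unique ((hasSum_congr fun a => ?_).2 ((hasSum_zeta_m_one_harmonic n).add
      (summable_one_div_add_one_pow (n + 1)).hasSum))
    rw [Finset.sum_range_succ]
    field_simp
    ring
  · intro a
    refine (hasSum_congr fun d => ?_).2
      ((hasSum_one_div_sub_one_div_add (a + 1)).div_const (((a : ℝ) + 1) ^ (n + 2)))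
    push_cast
    have : (d : ℝ) + (a + 1) + 1 ≠ 0 := by positivity
    have : (a : ℝ) + d + 2 ≠ 0 := by positivity
    field_simp
    ring

theorem hasSum_one_div_mul_mul_add_pow (n : ℕ) :
    HasSum (fun p : ℕ × ℕ => 1 / (((p.1 : ℝ) + 1) * (p.2 + 1) * (p.1 + p.2 + 2) ^ (n + 1)))
      (2 * zeta_m_one (n + 2)) := by
  have h := (summable_one_div_add_pow_mul n).hasSum
  rw [← zeta_m_one_eq_tsum_prod] at h
  rw [two_mul]
  convert h.add ((Equiv.prodComm ℕ ℕ).hasSum_iff.2 h) using 2 with p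
  dsimp
  rw [add_comm (p.2 : ℝ) p.1]
  field_simp
  ring

/-- The decomposition of `ℕ × ℕ` into the diagonal and the two strict triangles. -/
noncomputable def triangleEquiv : ℕ ⊕ ((ℕ × ℕ) ⊕ (ℕ × ℕ)) ≃ ℕ × ℕ :=
  Equiv.ofBijective
    (Sum.elim (fun a => (a, a))
      (Sum.elim (fun p => (p.1, p.1 + p.2 + 1)) (fun p => (p.1 + p.2 + 1, p.1)))) <| by
    constructor
    · rintro (a | ⟨a, d⟩ | ⟨a, d⟩) (b | ⟨b, e⟩ | ⟨b, e⟩) h <;>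
        simp at h ⊢ <;> omega
    · rintro ⟨a, b⟩
      rcases lt_trichotomy a b with h | rfl | h
      · exact ⟨Sum.inr (Sum.inl (a, b - a - 1)), by simp; omega⟩
      · exact ⟨Sum.inl a, rfl⟩
      · exact ⟨Sum.inr (Sum.inr (b, a - b - 1)), by simp; omega⟩

theorem HasSum.of_triangles {G : ℕ × ℕ → ℝ} {s t : ℝ} (hd : HasSum (fun a => G (a, a)) s)
    (hl : HasSum (fun p : ℕ × ℕ => G (p.1, p.1 + p.2 + 1)) t)
    (hr : HasSum (fun p : ℕ × ℕ => G (p.1 + p.2 + 1, p.1)) t) :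
    HasSum G (s + (t + t)) := by
  rw [← triangleEquiv.hasSum_iff]
  exact HasSum.sum hd (HasSum.sum hl hr)

theorem sum_range_one_div_pow_mul_pow_mul_sub {A B : ℝ} (hA : A ≠ 0) (hB : B ≠ 0) (n : ℕ) :
    (∑ i ∈ Finset.range n, 1 / A ^ (n + 1 - i) * (1 / B ^ (i + 2))) * (B - A)
      = 1 / (A ^ (n + 1) * B) - 1 / (A * B ^ (n + 1)) := by
  have e : ∑ i ∈ Finset.range n, 1 / A ^ (n + 1 - i) * (1 / B ^ (i + 2))
      = (A⁻¹ * B⁻¹) ^ 2 * ∑ i ∈ Finset.range n, B⁻¹ ^ i * A⁻¹ ^ (n - 1 - i) := by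
    rw [Finset.mul_sum]
    refine Finset.sum_congr rfl fun i hi => ?_
    have : n + 1 - i = (n - 1 - i) + 2 := by have := Finset.mem_range.1 hi; omega
    rw [this, one_div, one_div, ← inv_pow, ← inv_pow]
    ring
  have hs : B - A = -(B⁻¹ - A⁻¹) * (A * B) := by field_simp; ring
  have hg := geom_sum₂_mul B⁻¹ A⁻¹ n
  rw [e, hs]
  calc _ = -((A⁻¹ * B⁻¹) ^ 2 * (A * B)) *
        ((∑ i ∈ Finset.range n, B⁻¹ ^ i * A⁻¹ ^ (n - 1 - i)) * (B⁻¹ - A⁻¹)) := by ring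
    _ = _ := by
      rw [hg, inv_pow, inv_pow]
      field_simp
      ring

theorem hasSum_sum_rzeta_mul_rzeta (n : ℕ) :
    HasSum (fun p : ℕ × ℕ => ∑ i ∈ Finset.range n,
        1 / ((p.1 : ℝ) + 1) ^ (n + 1 - i) * (1 / ((p.2 : ℝ) + 1) ^ (i + 2)))
      (∑ i ∈ Finset.range n, rzeta (n + 1 - i) * rzeta (i + 2)) := by
  refine hasSum_sum (f := fun (i : ℕ) (p : ℕ × ℕ) =>
    1 / ((p.1 : ℝ) + 1) ^ (n + 1 - i) * (1 / ((p.2 : ℝ) + 1) ^ (i + 2))) fun i hi => ?_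
  obtain ⟨j, hj⟩ : ∃ j, n + 1 - i = j + 2 :=
    ⟨n - 1 - i, by have := Finset.mem_range.1 hi; omega⟩
  have hf := summable_one_div_add_one_pow j
  have hg := summable_one_div_add_one_pow i
  rw [hj]
  have h := hf.hasSum.mul hg.hasSum
    (hf.mul_of_nonneg hg (fun k => by positivity) (fun k => by positivity))
  rw [← rzeta, ← rzeta] at h
  exact h

theorem sum_rzeta_mul_rzeta (n : ℕ) :
    ∑ i ∈ Finset.range n, rzeta (n + 1 - i) * rzeta (i + 2)
      = (n + 2) * rzeta (n + 3) - 2 * zeta_m_one (n + 2) := by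
  have ht := (summable_one_div_pow_mul_mul_add n).hasSum.sub (hasSum_one_div_mul_mul_add_pow n)
  rw [tsum_one_div_pow_mul_mul_add] at ht
  have hd := (summable_one_div_add_one_pow (n + 1)).hasSum.mul_left (n : ℝ)
  refine (hasSum_sum_rzeta_mul_rzeta n).unique ?_
  have hs := HasSum.of_triangles (G := fun p : ℕ × ℕ => ∑ i ∈ Finset.range n,
      1 / ((p.1 : ℝ) + 1) ^ (n + 1 - i) * (1 / ((p.2 : ℝ) + 1) ^ (i + 2)))
    ((hasSum_congr fun a => ?_).2 hd) ((hasSum_congr fun p => ?_).2 ht)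
    ((hasSum_congr fun p => ?_).2 ht)
  · convert hs using 1
    rw [← rzeta]
    ring
  · rw [Finset.sum_congr rfl (g := fun _ => 1 / ((a : ℝ) + 1) ^ (n + 1 + 2))]
    · simp
    · intro i hi
      rw [one_div_mul_one_div, ← pow_add]
      congr 2
      have := Finset.mem_range.1 hi
      omega
  · have hA : (p.1 : ℝ) + 1 ≠ 0 := by positivity
    have hB : ((p.1 + p.2 + 1 : ℕ) : ℝ) + 1 ≠ 0 := by positivity
    have hD : (p.2 : ℝ) + 1 ≠ 0 := by positivity
    have h := sum_range_one_div_pow_mul_pow_mul_sub hA hB n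
    rw [show ((p.1 + p.2 + 1 : ℕ) : ℝ) + 1 - (p.1 + 1) = p.2 + 1 by push_cast; ring] at h
    rw [eq_div_of_mul_eq hD h]
    push_cast
    field_simp
    ring
  · have hA : (p.1 : ℝ) + 1 ≠ 0 := by positivity
    have hB : ((p.1 + p.2 + 1 : ℕ) : ℝ) + 1 ≠ 0 := by positivity
    have hD : -((p.2 : ℝ) + 1) ≠ 0 := neg_ne_zero.2 (by positivity)
    have h := sum_range_one_div_pow_mul_pow_mul_sub hB hA n
    rw [show (p.1 : ℝ) + 1 - (((p.1 + p.2 + 1 : ℕ) : ℝ) + 1) = -(p.2 + 1) by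
      push_cast; ring] at h
    rw [eq_div_of_mul_eq hD h]
    push_cast
    field_simp
    ring

/-- Euler's evaluation of ζ(m,1). -/
theorem euler_formula (m : ℕ) (hm : 2 ≤ m) :
    2 * zeta_m_one m
      = (m : ℝ) * rzeta (m + 1)
          - ∑ k ∈ Finset.Icc 1 (m - 2), rzeta (m - k) * rzeta (k + 1) := by
  obtain ⟨n, rfl⟩ := Nat.exists_eq_add_of_le' hm
  have h := sum_rzeta_mul_rzeta n
  have e : ∑ k ∈ Finset.Icc 1 (n + 2 - 2), rzeta (n + 2 - k) * rzeta (k + 1)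
      = ∑ i ∈ Finset.range n, rzeta (n + 1 - i) * rzeta (i + 2) := by
    rw [Nat.add_sub_cancel, Finset.range_eq_Ico, ← Finset.Ico_add_one_right_eq_Icc,
      ← Finset.sum_Ico_add' _ 0 n 1]
    refine Finset.sum_congr rfl fun i _ => ?_
    congr 2
    omega
  rw [e, h]
  push_cast
  ring
end
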